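/- Let 3/4 ≤ c < 1 and set γ_c⁰ = √(1 − (3/4)c) + (1/2)√c, γ_c^I = √(1 − (3/4)c) − (1/2)√c, and G_c(x) = e^{−√c x} Q³(x). Then there exists a unique smooth function A_c : ℝ → ℝ, with A_c^{(k)} square-integrable for all 0 ≤ k ≤ 10, satisfying (L A_c)' + √c(1 − c) A_c = G_c' on ℝ. Moreover: (i) for every k ≥ 0 there is C_k > 0 with |A_c^{(k)}(x)| ≤ C_k e^{γ_c⁰ x} for x < 0 and |A_c^{(k)}(x)| ≤ C_k e^{−γ_c^I x} for x > 0; (ii) there exist real numbers a_c^I, a_c^{II} such that for every k ≥ 0 there is C_k > 0 with |(d/dx)^k (A_c(x) − a_c^I e^{−γ_c^I x} − a_c^{II} e^{−√c x})| ≤ C_k e^{−(3/2)x} for all x > 0. -/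

import Mathlib

open Real MeasureTheory Filter

noncomputable def Q (x : ℝ) : ℝ := (5 / (2 * Real.cosh (3 * x / 2) ^ 2)) ^ ((1:ℝ)/3)

/-- The linearized operator `L f = −f'' + f − 4Q³ f`. -/
noncomputable def LQ (f : ℝ → ℝ) : ℝ → ℝ :=
  fun x => -iteratedDeriv 2 f x + f x - 4 * (Q x) ^ 3 * f x

/-- `A` is the solution of `(L A)' + √c(1−c) A = (e^{−√c x} Q³)'` which is smooth with
square-integrable derivatives up to order 10. -/
noncomputable def IsAc (c : ℝ) (A : ℝ → ℝ) : Prop :=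
  ContDiff ℝ (⊤ : ℕ∞) A ∧
  (∀ k : ℕ, k ≤ 10 → Integrable (fun x => (iteratedDeriv k A x) ^ 2)) ∧
  (∀ x : ℝ, deriv (LQ A) x + Real.sqrt c * (1 - c) * A x
    = deriv (fun y => Real.exp (-(Real.sqrt c) * y) * (Q y) ^ 3) x)

open Topology Set

/-- The logarithmic slope `tanh (3x/2) = -Q'/Q` of the soliton. -/
noncomputable def kink (x : ℝ) : ℝ := Real.tanh (3 * x / 2)

lemma hasDerivAt_kink (x : ℝ) : HasDerivAt kink (3 / 2 * (1 - kink x ^ 2)) x := by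
  have h1 : HasDerivAt (fun x : ℝ => 3 * x / 2) (3 / 2) x := by
    simpa using ((hasDerivAt_id x).const_mul 3).div_const 2
  have hc : Real.cosh (3 * x / 2) ≠ 0 := (Real.cosh_pos _).ne'
  have h2 := (h1.sinh).div h1.cosh hc
  have hfun : kink = (fun x => Real.sinh (3 * x / 2)) / fun x => Real.cosh (3 * x / 2) := by
    funext y; simp [kink, Real.tanh_eq_sinh_div_cosh]
  rw [hfun]
  refine h2.congr_deriv ?_
  simp only [Pi.div_apply]
  field_simp

lemma kink_sq_lt_one (x : ℝ) : kink x ^ 2 < 1 := Real.tanh_sq_lt_one _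

lemma abs_kink_le_one (x : ℝ) : |kink x| ≤ 1 := (Real.abs_tanh_lt_one _).le

lemma kink_zero : kink 0 = 0 := by simp [kink]

lemma kink_ne_zero {x : ℝ} (hx : x ≠ 0) : kink x ≠ 0 := by
  rw [kink, Real.tanh_eq_sinh_div_cosh]
  refine div_ne_zero ?_ (Real.cosh_pos _).ne'
  rw [Ne, Real.sinh_eq_zero]
  intro h
  exact hx (by linarith)

lemma Q_pos (x : ℝ) : 0 < Q x := by
  have := Real.cosh_pos (3 * x / 2)
  unfold Q
  positivity

lemma Q_cube_eq_cosh (x : ℝ) : Q x ^ 3 = 5 / (2 * Real.cosh (3 * x / 2) ^ 2) := by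
  have := Real.cosh_pos (3 * x / 2)
  unfold Q
  rw [← Real.rpow_natCast, ← Real.rpow_mul (by positivity)]
  norm_num

lemma Q_cube (x : ℝ) : Q x ^ 3 = 5 / 2 * (1 - kink x ^ 2) := by
  have := Real.cosh_pos (3 * x / 2)
  have h := Real.cosh_sq (3 * x / 2)
  rw [Q_cube_eq_cosh, kink, Real.tanh_eq_sinh_div_cosh]
  field_simp
  linarith

lemma hasDerivAt_Q_cube (x : ℝ) :
    HasDerivAt (fun y => Q y ^ 3) (-3 * kink x * Q x ^ 3) x := by
  have hfun : (fun y => Q y ^ 3) = fun y => 5 / 2 * (1 - kink y ^ 2) := funext Q_cube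
  rw [hfun, Q_cube]
  refine ((((hasDerivAt_kink x).pow 2).const_sub 1).const_mul (5 / 2)).congr_deriv ?_
  push_cast
  ring

lemma hasDerivAt_Q (x : ℝ) : HasDerivAt Q (-kink x * Q x) x := by
  have hfun : Q = fun y => (Q y ^ 3) ^ ((1 : ℝ) / 3) := by
    funext y; rw [Q_cube_eq_cosh, Q]
  have h0 : Q x ^ 3 ≠ 0 := (pow_pos (Q_pos x) 3).ne'
  have h := (hasDerivAt_Q_cube x).rpow_const (p := (1 : ℝ) / 3) (Or.inl h0)
  rw [← hfun] at h
  refine h.congr_deriv ?_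
  rw [Real.rpow_sub_one h0, ← congrFun hfun x]
  have := Q_pos x
  field_simp

lemma Q_cube_le (x : ℝ) : Q x ^ 3 ≤ 10 * Real.exp (-3 * |x|) := by
  have h1 : Real.exp (3 / 2 * |x|) / 2 ≤ Real.cosh (3 * x / 2) := by
    rw [← Real.cosh_abs, Real.cosh_eq, abs_div, abs_mul, abs_of_pos (by norm_num : (0 : ℝ) < 3),
      abs_of_pos (by norm_num : (0 : ℝ) < 2)]
    have := Real.exp_pos (-(3 * |x| / 2))
    have h : 3 / 2 * |x| = 3 * |x| / 2 := by ring
    rw [h]; linarith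
  have h2 : Real.exp (3 * |x|) = Real.exp (3 / 2 * |x|) ^ 2 := by
    rw [← Real.exp_nat_mul]; congr 1; push_cast; ring
  have h3 := Real.exp_pos (3 / 2 * |x|)
  have hc := Real.cosh_pos (3 * x / 2)
  rw [Q_cube_eq_cosh, neg_mul, Real.exp_neg, h2, div_le_iff₀ (by positivity)]
  have h4 : (Real.exp (3 / 2 * |x|) / 2) ^ 2 ≤ Real.cosh (3 * x / 2) ^ 2 := by gcongr
  rw [mul_comm (10 : ℝ), mul_assoc, inv_mul_eq_div, le_div_iff₀ (by positivity)]
  linarith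

lemma Q_le (x : ℝ) : Q x ≤ 3 * Real.exp (-|x|) := by
  refine le_of_pow_le_pow_left₀ (n := 3) (by norm_num) (by positivity) ?_
  have h : (3 * Real.exp (-|x|)) ^ 3 = 27 * Real.exp (-3 * |x|) := by
    rw [mul_pow, ← Real.exp_nat_mul]
    norm_num
  rw [h]
  have := Real.exp_pos (-3 * |x|)
  linarith [Q_cube_le x]

lemma tendsto_exp_neg_abs_cocompact : Tendsto (fun x : ℝ => Real.exp (-|x|)) (cocompact ℝ) (𝓝 0) :=
  Real.tendsto_exp_atBot.comp (tendsto_neg_atTop_atBot.comp tendsto_norm_cocompact_atTop)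

lemma tendsto_Q_cocompact : Tendsto Q (cocompact ℝ) (𝓝 0) := by
  refine squeeze_zero (fun x => (Q_pos x).le) Q_le ?_
  simpa using tendsto_exp_neg_abs_cocompact.const_mul 3

lemma tendsto_mul_Q_cocompact : Tendsto (fun x => x * Q x) (cocompact ℝ) (𝓝 0) := by
  have h : Tendsto (fun x : ℝ => 3 * (|x| ^ 1 * Real.exp (-|x|))) (cocompact ℝ) (𝓝 (3 * 0)) :=
    ((Real.tendsto_pow_mul_exp_neg_atTop_nhds_zero 1).comp tendsto_norm_cocompact_atTop).const_mul 3
  rw [mul_zero] at h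
  refine squeeze_zero_norm (fun x => ?_) h
  rw [norm_mul, Real.norm_eq_abs, Real.norm_eq_abs, abs_of_pos (Q_pos x), pow_one]
  nlinarith [Q_le x, abs_nonneg x]

lemma tendsto_kink_mul {l : Filter ℝ} {f : ℝ → ℝ} (hf : Tendsto f l (𝓝 0)) :
    Tendsto (fun x => kink x * f x) l (𝓝 0) := by
  refine squeeze_zero_norm (fun x => ?_) (tendsto_zero_iff_norm_tendsto_zero.1 hf)
  rw [norm_mul]
  exact mul_le_of_le_one_left (norm_nonneg _) (abs_kink_le_one x)

lemma hasDerivAt_kink_mul_Q (x : ℝ) :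
    HasDerivAt (fun y => kink y * Q y) ((3 / 2 - 5 / 2 * kink x ^ 2) * Q x) x :=
  ((hasDerivAt_kink x).mul (hasDerivAt_Q x)).congr_deriv (by ring)

lemma hasDerivAt_Q_second (x : ℝ) :
    HasDerivAt (fun y => (5 / 2 * kink y ^ 2 - 3 / 2) * Q y)
      (-(1 - 10 * (1 - kink x ^ 2)) * (kink x * Q x)) x := by
  refine (((((hasDerivAt_kink x).pow 2).const_mul (5 / 2)).sub_const (3 / 2)).mul
    (hasDerivAt_Q x)).congr_deriv ?_
  simp only [Pi.pow_apply]
  push_cast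
  ring

/-- The scaling generator `Q / 3 + x Q' / 2`, which `LQ` maps to `-Q`. -/
noncomputable def scalingQ (x : ℝ) : ℝ := Q x / 3 - x * (kink x * Q x) / 2

/-- The derivative of `scalingQ`. -/
noncomputable def scalingQ' (x : ℝ) : ℝ :=
  -(5 / 6) * (kink x * Q x) + x * ((5 / 2 * kink x ^ 2 - 3 / 2) * Q x) / 2

lemma hasDerivAt_scalingQ (x : ℝ) : HasDerivAt scalingQ (scalingQ' x) x := by
  refine (((hasDerivAt_Q x).div_const 3).sub
    (((hasDerivAt_id x).mul (hasDerivAt_kink_mul_Q x)).div_const 2)).congr_deriv ?_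
  simp only [scalingQ', id]
  ring

lemma hasDerivAt_scalingQ' (x : ℝ) :
    HasDerivAt scalingQ' ((1 - 10 * (1 - kink x ^ 2)) * scalingQ x + Q x) x := by
  refine (((hasDerivAt_kink_mul_Q x).const_mul (-(5 / 6))).add
    (((hasDerivAt_id x).mul (hasDerivAt_Q_second x)).div_const 2)).congr_deriv ?_
  simp only [scalingQ, id]
  ring

lemma tendsto_scalingQ_cocompact : Tendsto scalingQ (cocompact ℝ) (𝓝 0) := by
  have h := (tendsto_Q_cocompact.div_const 3).sub
    ((tendsto_kink_mul tendsto_mul_Q_cocompact).div_const 2)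
  simp only [zero_div, sub_zero] at h
  refine h.congr fun x => ?_
  simp only [scalingQ]
  ring

lemma tendsto_scalingQ'_cocompact : Tendsto scalingQ' (cocompact ℝ) (𝓝 0) := by
  have h1 := tendsto_kink_mul tendsto_Q_cocompact
  have h2 := tendsto_kink_mul (tendsto_kink_mul tendsto_mul_Q_cocompact)
  have h := ((h1.const_mul (-(5 / 6))).add (h2.const_mul (5 / 4))).sub
    (tendsto_mul_Q_cocompact.const_mul (3 / 4))
  simp only [mul_zero, add_zero, sub_zero] at h
  refine h.congr fun x => ?_
  simp only [scalingQ']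
  ring

/-- The logarithmic derivative `Q'' / Q'` of `Q'`; its value at `0` is `0`. -/
noncomputable def logDerivQ' (x : ℝ) : ℝ := (3 / 2 - 5 / 2 * kink x ^ 2) / kink x

lemma hasDerivAt_logDerivQ' {x : ℝ} (hx : x ≠ 0) :
    HasDerivAt logDerivQ' (1 - 10 * (1 - kink x ^ 2) - logDerivQ' x ^ 2) x := by
  have hk := kink_ne_zero hx
  have hk' := hasDerivAt_kink x
  refine ((((hk'.pow 2).const_mul (5 / 2)).const_sub (3 / 2)).div hk' hk).congr_deriv ?_
  simp only [logDerivQ', Pi.pow_apply]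
  field_simp
  push_cast
  ring

lemma tendsto_logDerivQ'_mul_sq_cocompact {B : ℝ → ℝ} (hB : Tendsto B (cocompact ℝ) (𝓝 0)) :
    Tendsto (fun x => logDerivQ' x * B x ^ 2) (cocompact ℝ) (𝓝 0) := by
  have hQ : Tendsto (fun x => Q x ^ 3) (cocompact ℝ) (𝓝 0) := by
    simpa using tendsto_Q_cocompact.pow 3
  have hB2 : Tendsto (fun x => 8 * B x ^ 2) (cocompact ℝ) (𝓝 0) := by
    simpa using (hB.pow 2).const_mul 8
  have hev : ∀ᶠ x in cocompact ℝ, ‖logDerivQ' x * B x ^ 2‖ ≤ 8 * B x ^ 2 := by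
    filter_upwards [hQ.eventually (gt_mem_nhds (by norm_num : (0 : ℝ) < 1))] with x hx
    rw [Q_cube] at hx
    have hk : 1 / 2 ≤ |kink x| := by
      by_contra hlt
      push Not at hlt
      nlinarith [sq_abs (kink x), abs_nonneg (kink x)]
    have h1 : |3 / 2 - 5 / 2 * kink x ^ 2| ≤ 4 := by
      rw [abs_le]
      constructor <;> nlinarith [kink_sq_lt_one x, sq_nonneg (kink x)]
    rw [norm_mul, Real.norm_eq_abs, Real.norm_eq_abs, abs_of_nonneg (sq_nonneg (B x)), logDerivQ',
      abs_div]
    refine mul_le_mul_of_nonneg_right ?_ (sq_nonneg _)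
    rw [div_le_iff₀ (by linarith)]
    linarith
  exact squeeze_zero_norm' hev hB2

lemma continuousAt_logDerivQ'_mul_sq {B : ℝ → ℝ} {B' : ℝ} (hB : HasDerivAt B B' 0)
    (hB0 : B 0 = 0) : ContinuousAt (fun x => logDerivQ' x * B x ^ 2) 0 := by
  rw [continuousAt_iff_punctured_nhds]
  have h1 := hasDerivAt_iff_tendsto_slope.1 hB
  have h2 := hasDerivAt_iff_tendsto_slope.1 (hasDerivAt_kink 0)
  rw [kink_zero] at h2
  have hk : Tendsto kink (𝓝[≠] 0) (𝓝 0) := by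
    simpa [kink_zero] using (hasDerivAt_kink 0).continuousAt.continuousWithinAt.tendsto
  have hb : Tendsto B (𝓝[≠] 0) (𝓝 0) := by
    simpa [hB0] using hB.continuousAt.continuousWithinAt.tendsto
  have h3 := ((((hk.pow 2).const_mul (5 / 2)).const_sub (3 / 2)).mul hb).mul
    (h1.div h2 (by norm_num))
  simp only [mul_zero, zero_mul, hB0, ne_eq, OfNat.ofNat_ne_zero, not_false_eq_true,
    zero_pow] at h3 ⊢
  refine h3.congr' ?_
  filter_upwards [self_mem_nhdsWithin] with x hx
  have hx : x ≠ 0 := hx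
  have hk0 := kink_ne_zero hx
  simp only [slope_def_field, hB0, kink_zero, logDerivQ', sub_zero, Pi.div_apply]
  field_simp

/-- The linearised flow has no decaying eigenfunction with positive eigenvalue. -/
lemma eq_zero_of_linearized_eigenfunction {lam : ℝ} (hlam : 0 < lam) {A0 A1 A2 : ℝ → ℝ}
    (h0 : ∀ x, HasDerivAt A0 (A1 x) x) (h1 : ∀ x, HasDerivAt A1 (A2 x) x)
    (h2 : ∀ x, HasDerivAt A2 (A1 x + lam * A0 x
      + (-4 * Q x ^ 3 * A1 x + 12 * kink x * Q x ^ 3 * A0 x)) x)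
    (t0 : Tendsto A0 (cocompact ℝ) (𝓝 0)) (t1 : Tendsto A1 (cocompact ℝ) (𝓝 0))
    (t2 : Tendsto A2 (cocompact ℝ) (𝓝 0)) (x : ℝ) : A0 x = 0 := by
  set u : ℝ → ℝ := fun x => -A2 x + (1 - 10 * (1 - kink x ^ 2)) * A0 x with hu
  have du : ∀ x, HasDerivAt u (-lam * A0 x) x := by
    intro x
    refine ((h2 x).neg.add ((((((hasDerivAt_kink x).pow 2).const_sub 1).const_mul 10).const_sub
      1).mul (h0 x))).congr_deriv ?_
    rw [Q_cube]
    simp only [Pi.pow_apply]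
    push_cast
    ring
  have tk := tendsto_kink_mul (tendsto_kink_mul t0)
  have tu : Tendsto u (cocompact ℝ) (𝓝 0) := by
    have h := (t2.neg.sub (t0.const_mul 9)).add (tk.const_mul 10)
    simp only [mul_zero, neg_zero, sub_zero, add_zero] at h
    exact h.congr fun x => by simp only [hu]; ring
  -- `W` is a decaying primitive of `A0 * Q`.
  set W : ℝ → ℝ := fun x => (-(u x * Q x) + A1 x * (kink x * Q x)
    + A0 x * ((5 / 2 * kink x ^ 2 - 3 / 2) * Q x)) / lam with hW
  have dW : ∀ x, HasDerivAt W (A0 x * Q x) x := by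
    intro x
    refine (((((du x).mul (hasDerivAt_Q x)).neg.add ((h1 x).mul (hasDerivAt_kink_mul_Q x))).add
      ((h0 x).mul (hasDerivAt_Q_second x))).div_const lam).congr_deriv ?_
    simp only [hu]
    field_simp
    ring
  have tW : Tendsto W (cocompact ℝ) (𝓝 0) := by
    have tQ := tendsto_Q_cocompact
    have t1Q : Tendsto (fun x => A1 x * Q x) (cocompact ℝ) (𝓝 0) := by simpa using t1.mul tQ
    have h := ((((tu.mul tQ).neg.add (tendsto_kink_mul t1Q)).add
      ((tk.mul tQ).const_mul (5 / 2))).sub ((t0.mul tQ).const_mul (3 / 2))).div_const lam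
    simp only [mul_zero, neg_zero, sub_zero, add_zero, zero_div] at h
    exact h.congr fun x => by simp only [hW]; ring
  set α : ℝ := A0 0 / scalingQ 0 with hα
  have hS0 : scalingQ 0 ≠ 0 := by
    have := (Q_pos 0).ne'
    simp [scalingQ, this]
  set B : ℝ → ℝ := fun x => A0 x - α * scalingQ x with hB
  have dB : ∀ x, HasDerivAt B (A1 x - α * scalingQ' x) x := fun x =>
    (h0 x).sub ((hasDerivAt_scalingQ x).const_mul α)
  have hB0 : B 0 = 0 := by
    simp only [hB, hα]
    field_simp
    ring
  have tB : Tendsto B (cocompact ℝ) (𝓝 0) := by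
    simpa using t0.sub (tendsto_scalingQ_cocompact.const_mul α)
  set Z : ℝ → ℝ := fun x => A0 x * A1 x - u x ^ 2 / (2 * lam)
    - 2 * α * (A0 x * scalingQ' x - W x)
    + α ^ 2 * (scalingQ x * scalingQ' x - x * Q x ^ 2 / 4) with hZ
  have dZ : ∀ x, HasDerivAt Z ((A1 x - α * scalingQ' x) ^ 2
      + (1 - 10 * (1 - kink x ^ 2)) * B x ^ 2 + α ^ 2 * Q x ^ 2 / 12) x := by
    intro x
    refine (((((h0 x).mul (h1 x)).sub (((du x).pow 2).div_const (2 * lam))).sub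
      ((((h0 x).mul (hasDerivAt_scalingQ' x)).sub (dW x)).const_mul (2 * α))).add
      ((((hasDerivAt_scalingQ x).mul (hasDerivAt_scalingQ' x)).sub
        (((hasDerivAt_id x).mul ((hasDerivAt_Q x).pow 2)).div_const 4)).const_mul
          (α ^ 2))).congr_deriv ?_
    simp only [hu, hB, id, scalingQ, Pi.pow_apply]
    push_cast
    field_simp
    ring
  have tZ : Tendsto Z (cocompact ℝ) (𝓝 0) := by
    have h := (((t0.mul t1).sub ((tu.pow 2).div_const (2 * lam))).sub
      (((t0.mul tendsto_scalingQ'_cocompact).sub tW).const_mul (2 * α))).add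
      (((tendsto_scalingQ_cocompact.mul tendsto_scalingQ'_cocompact).sub
        ((tendsto_mul_Q_cocompact.mul tendsto_Q_cocompact).div_const 4)).const_mul (α ^ 2))
    simp only [mul_zero, sub_zero, add_zero, zero_div, ne_eq, OfNat.ofNat_ne_zero,
      not_false_eq_true, zero_pow] at h
    exact h.congr fun x => by simp only [hZ]; ring
  set Y : ℝ → ℝ := fun x => Z x - logDerivQ' x * B x ^ 2 with hY
  have dY : ∀ x, x ≠ 0 → HasDerivAt Y ((A1 x - α * scalingQ' x - logDerivQ' x * B x) ^ 2
      + α ^ 2 * Q x ^ 2 / 12) x := by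
    intro x hx
    refine ((dZ x).sub ((hasDerivAt_logDerivQ' hx).mul ((dB x).pow 2))).congr_deriv ?_
    simp only [Pi.pow_apply]
    push_cast
    ring
  have tY : Tendsto Y (cocompact ℝ) (𝓝 0) := by
    simpa using tZ.sub (tendsto_logDerivQ'_mul_sq_cocompact tB)
  have cY : Continuous Y := continuous_iff_continuousAt.2 fun x => by
    rcases eq_or_ne x 0 with rfl | hx
    · exact (dZ 0).continuousAt.sub (continuousAt_logDerivQ'_mul_sq (dB 0) hB0)
    · exact (dY x hx).continuousAt
  have mono : Monotone Y := by
    have hpos : ∀ x, x ≠ 0 → 0 ≤ deriv Y x := fun x hx => by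
      rw [(dY x hx).deriv]; positivity
    have hr : MonotoneOn Y (Ici 0) := by
      refine monotoneOn_of_deriv_nonneg (convex_Ici 0) cY.continuousOn ?_ ?_ <;>
        rw [interior_Ici] <;> intro x hx
      · exact (dY x (ne_of_gt hx)).differentiableAt.differentiableWithinAt
      · exact hpos x (ne_of_gt hx)
    have hl : MonotoneOn Y (Iic 0) := by
      refine monotoneOn_of_deriv_nonneg (convex_Iic 0) cY.continuousOn ?_ ?_ <;>
        rw [interior_Iic] <;> intro x hx
      · exact (dY x (ne_of_lt hx)).differentiableAt.differentiableWithinAt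
      · exact hpos x (ne_of_lt hx)
    exact hl.Iic_union_Ici hr
  have Y0 : Y = fun _ => 0 := by
    funext x
    rw [cocompact_eq_atBot_atTop, tendsto_sup] at tY
    exact le_antisymm (mono.ge_of_tendsto tY.2 x) (mono.le_of_tendsto tY.1 x)
  have key : ∀ x, x ≠ 0 → (A1 x - α * scalingQ' x - logDerivQ' x * B x) ^ 2
      + α ^ 2 * Q x ^ 2 / 12 = 0 := fun x hx => by
    have h := dY x hx
    rw [Y0] at h
    exact h.unique (hasDerivAt_const x 0)
  have hα0 : α = 0 := by
    have h := key 1 one_ne_zero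
    have hQ := Q_pos 1
    by_contra hne
    have : 0 < α ^ 2 * Q 1 ^ 2 / 12 := by positivity
    nlinarith [sq_nonneg (A1 1 - α * scalingQ' 1 - logDerivQ' 1 * B 1)]
  have hA1 : ∀ x, x ≠ 0 → A1 x = logDerivQ' x * A0 x := fun x hx => by
    have h := key x hx
    simp only [hB, hα0] at h
    simp only [zero_mul, sub_zero, ne_eq, OfNat.ofNat_ne_zero, not_false_eq_true, zero_pow,
      zero_div, add_zero, pow_eq_zero_iff] at h
    linarith
  have hu0 : ∀ x, x ≠ 0 → u x = 0 := fun x hx => by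
    have hev : A1 =ᶠ[𝓝 x] fun y => logDerivQ' y * A0 y := by
      filter_upwards [isOpen_ne.mem_nhds hx] with y hy using hA1 y hy
    have h := ((h1 x).congr_of_eventuallyEq hev.symm).unique
      ((hasDerivAt_logDerivQ' hx).mul (h0 x))
    simp only [hu, h, hA1 x hx]
    ring
  have hA0 : ∀ x, x ≠ 0 → A0 x = 0 := fun x hx => by
    have hev : u =ᶠ[𝓝 x] fun _ => 0 := by
      filter_upwards [isOpen_ne.mem_nhds hx] with y hy using hu0 y hy
    have h := ((du x).congr_of_eventuallyEq hev.symm).unique (hasDerivAt_const x 0)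
    exact (mul_eq_zero.1 h).resolve_left (neg_ne_zero.2 hlam.ne')
  rcases eq_or_ne x 0 with rfl | hx
  · have := hB0
    simpa [hB, hα0] using this
  · exact hA0 x hx

/-- **Global Picard–Lindelöf theorem**: a vector field that is globally Lipschitz in space has a
solution on the whole time interval. -/
lemma exists_forall_hasDerivWithinAt_of_lipschitzWith {n : ℕ} {v : ℝ → (Fin n → ℝ) → Fin n → ℝ}
    {T : ℝ} (hT : 0 ≤ T) {K : NNReal} (hv : ∀ t ∈ Icc 0 T, LipschitzWith K (v t))
    (hc : ∀ x, ContinuousOn (fun t => v t x) (Icc 0 T)) (x₀ : Fin n → ℝ) :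
    ∃ γ : ℝ → Fin n → ℝ, γ 0 = x₀ ∧
      ∀ t ∈ Icc 0 T, HasDerivWithinAt γ (v t (γ t)) (Icc 0 T) t := by
  obtain ⟨M, hM⟩ := isCompact_Icc.exists_bound_of_continuousOn (hc 0)
  have hM0 : 0 ≤ M := (norm_nonneg _).trans (hM 0 ⟨le_rfl, hT⟩)
  set R : ℝ := gronwallBound ‖x₀‖ K M T with hR
  have hmono := gronwallBound_mono (norm_nonneg x₀) hM0 K.coe_nonneg
  have hR0 : 0 ≤ R := by
    have := hmono hT
    rw [gronwallBound_x0] at this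
    exact (norm_nonneg x₀).trans this
  -- Truncate the vector field outside the ball of radius `R`, which no solution leaves.
  set clip : (Fin n → ℝ) → Fin n → ℝ := fun x i => max (-R) (min R (x i)) with hclip
  have clip_lip : LipschitzWith 1 clip := by
    refine LipschitzWith.of_dist_le_mul fun x y => ?_
    rw [NNReal.coe_one, one_mul, dist_pi_le_iff dist_nonneg]
    intro i
    have h := ((LipschitzWith.id (α := ℝ)).const_min R).const_max (-R)
    have h1 := h.dist_le_mul (x i) (y i)
    rw [NNReal.coe_one, one_mul] at h1
    exact h1.trans (dist_le_pi_dist x y i)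
  have clip_R : ∀ x, ‖clip x‖ ≤ R := fun x => by
    rw [pi_norm_le_iff_of_nonneg hR0]
    intro i
    rw [Real.norm_eq_abs, abs_le]
    exact ⟨le_max_left _ _, max_le (by linarith) (min_le_left _ _)⟩
  have clip_eq : ∀ x, ‖x‖ ≤ R → clip x = x := fun x hx => by
    funext i
    have h := abs_le.1 ((norm_le_pi_norm x i).trans hx)
    simp only [hclip]
    rw [min_eq_right h.2, max_eq_right h.1]
  have clip_zero : clip 0 = 0 := clip_eq 0 (by simpa using hR0)
  have clip_le : ∀ x, ‖clip x‖ ≤ ‖x‖ := fun x => by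
    simpa [dist_eq_norm, clip_zero] using clip_lip.dist_le_mul x 0
  have hgrow : ∀ t ∈ Icc 0 T, ∀ x, ‖v t x‖ ≤ K * ‖x‖ + M := fun t ht x => by
    have h1 := (hv t ht).dist_le_mul x 0
    rw [dist_eq_norm, dist_zero_right] at h1
    have h2 := norm_le_norm_sub_add (v t x) (v t 0)
    linarith [hM t ht]
  set Lb : NNReal := ⟨K * R + M, by positivity⟩ with hLb
  set a : NNReal := Lb * ⟨T, hT⟩ with ha
  have hPL : IsPicardLindelof (fun t x => v t (clip x)) (⟨0, le_rfl, hT⟩ : Icc 0 T) x₀ a 0 Lb K :=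
    { lipschitzOnWith := fun t ht => by
        have h := ((hv t ht).comp clip_lip).lipschitzOnWith (s := Metric.closedBall x₀ a)
        rw [mul_one] at h
        exact h
      continuousOn := fun x _ => hc (clip x)
      norm_le := fun t ht x _ => by
        refine (hgrow t ht _).trans ?_
        change _ ≤ (K : ℝ) * R + M
        gcongr
        exact clip_R x
      mul_max_le := by
        simp only [sub_zero, sub_self, max_eq_left hT, NNReal.coe_zero]
        exact le_rfl }
  obtain ⟨γ, hγ0, hγ⟩ := hPL.exists_eq_forall_mem_Icc_hasDerivWithinAt₀
  refine ⟨γ, hγ0, fun t ht => ?_⟩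
  have hγt := hγ t ht
  have hbound := norm_le_gronwallBound_of_norm_deriv_right_le (f := γ)
    (f' := fun t => v t (clip (γ t))) (δ := ‖x₀‖) (K := K) (ε := M) (a := 0) (b := T)
    (fun s hs => (hγ s hs).continuousWithinAt)
    (fun s hs => (hγ s ⟨hs.1, hs.2.le⟩).mono_of_mem_nhdsWithin (Icc_mem_nhdsGE_of_mem hs))
    (by simp [hγ0])
    (fun s hs => (hgrow s ⟨hs.1, hs.2.le⟩ _).trans (by gcongr; exact clip_le _)) t ht
  have hle : ‖γ t‖ ≤ R := hbound.trans (hmono (by linarith [ht.2]))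
  rwa [clip_eq _ hle] at hγt

lemma continuousOn_div_mul_comp_log {F : ℝ → ℝ} (hF : Continuous F) {K : ℝ}
    (hK : ∀ x, 0 ≤ x → |F x| ≤ K * Real.exp (-x)) (s : Set ℝ) (hs : s ⊆ Ici 0) :
    ContinuousOn (fun τ => -(2 / τ) * F (-2 * Real.log τ)) s := by
  intro τ hτ
  have hτ0 : 0 ≤ τ := hs hτ
  rcases hτ0.eq_or_lt with rfl | hpos
  · refine ContinuousWithinAt.mono (t := Ici 0) ?_ hs
    rw [ContinuousWithinAt]
    simp only [div_zero, neg_zero, zero_mul]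
    have h0 : Tendsto (fun τ : ℝ => 2 * K * τ) (𝓝[Ici 0] 0) (𝓝 0) := by
      have : Continuous fun τ : ℝ => 2 * K * τ := by fun_prop
      simpa using this.continuousWithinAt.tendsto (x := 0) (s := Ici 0)
    refine squeeze_zero_norm' ?_ h0
    filter_upwards [self_mem_nhdsWithin, mem_nhdsWithin_of_mem_nhds (Iio_mem_nhds one_pos)]
      with τ hτ hτ1
    have hτ0 : 0 ≤ τ := hτ
    rcases hτ0.eq_or_lt with rfl | hpos
    · simp
    · have hlog : Real.log τ ≤ 0 := Real.log_nonpos hpos.le (le_of_lt hτ1)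
      have h := hK (-2 * Real.log τ) (by linarith)
      have hexp : Real.exp (-(-2 * Real.log τ)) = τ ^ 2 := by
        rw [show -(-2 * Real.log τ) = ((2 : ℕ) : ℝ) * Real.log τ by push_cast; ring,
          Real.exp_nat_mul, Real.exp_log hpos]
      rw [hexp] at h
      rw [norm_mul, Real.norm_eq_abs, Real.norm_eq_abs, abs_neg, abs_of_pos (by positivity),
        div_mul_eq_mul_div, div_le_iff₀ hpos]
      nlinarith
  · have hne := hpos.ne'
    have hlog := Real.continuousAt_log hne
    refine ContinuousAt.continuousWithinAt ?_
    exact ((continuousAt_const.div continuousAt_id hne).neg).mul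
      (ContinuousAt.comp (g := F) hF.continuousAt (continuousAt_const.mul hlog))

/-- A linear system whose coefficients decay exponentially has a solution on the half-line with
any prescribed limit at infinity. -/
lemma exists_linear_system_tendsto {n : ℕ} {P : ℝ → Fin n → Fin n → ℝ} {f : ℝ → Fin n → ℝ}
    {K : ℝ} (hP : ∀ i j, Continuous fun x => P x i j) (hf : ∀ i, Continuous fun x => f x i)
    (hPK : ∀ i j x, 0 ≤ x → |P x i j| ≤ K * Real.exp (-x))
    (hfK : ∀ i x, 0 ≤ x → |f x i| ≤ K * Real.exp (-x)) (c₀ : Fin n → ℝ) :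
    ∃ c : ℝ → Fin n → ℝ,
      (∀ x, 0 ≤ x → ∀ i, HasDerivAt (fun y => c y i) (∑ j, P x i j * c x j + f x i) x) ∧
      (∀ i, Tendsto (fun x => c x i) atTop (𝓝 (c₀ i))) ∧
      ∃ M, ∀ x, 0 ≤ x → ∀ i, |c x i| ≤ M := by
  set p : ℝ → Fin n → Fin n → ℝ := fun τ i j => -(2 / τ) * P (-2 * Real.log τ) i j with hp
  set g : ℝ → Fin n → ℝ := fun τ i => -(2 / τ) * f (-2 * Real.log τ) i with hg
  have hpc : ∀ i j, ContinuousOn (fun τ => p τ i j) (Icc 0 2) := fun i j =>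
    continuousOn_div_mul_comp_log (hP i j) (hPK i j) _ fun τ hτ => hτ.1
  have hgc : ∀ i, ContinuousOn (fun τ => g τ i) (Icc 0 2) := fun i =>
    continuousOn_div_mul_comp_log (hf i) (hfK i) _ fun τ hτ => hτ.1
  have hpc' : ContinuousOn p (Icc 0 2) :=
    continuousOn_pi.2 fun i => continuousOn_pi.2 fun j => hpc i j
  obtain ⟨Kp, hKp⟩ := isCompact_Icc.exists_bound_of_continuousOn hpc'
  have hKp0 : 0 ≤ Kp := (norm_nonneg _).trans (hKp 0 ⟨le_rfl, by norm_num⟩)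
  obtain ⟨γ, hγ0, hγ⟩ := exists_forall_hasDerivWithinAt_of_lipschitzWith (n := n)
    (v := fun τ y i => ∑ j, p τ i j * y j + g τ i) (T := 2) (by norm_num)
    (K := ⟨n * Kp, by positivity⟩)
    (fun τ hτ => by
      refine LipschitzWith.of_dist_le_mul fun y z => ?_
      change _ ≤ (n * Kp) * _
      rw [dist_pi_le_iff (by positivity)]
      intro i
      rw [Real.dist_eq, add_sub_add_right_eq_sub, ← Finset.sum_sub_distrib]
      refine (Finset.abs_sum_le_sum_abs _ _).trans ?_
      have hterm : ∀ j ∈ (Finset.univ : Finset (Fin n)),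
          |p τ i j * y j - p τ i j * z j| ≤ Kp * dist y z := fun j _ => by
        rw [← mul_sub, abs_mul]
        refine mul_le_mul ?_ (dist_le_pi_dist y z j) (abs_nonneg _) hKp0
        exact ((norm_le_pi_norm (p τ i) j).trans (norm_le_pi_norm (p τ) i)).trans (hKp τ hτ)
      refine (Finset.sum_le_sum hterm).trans ?_
      simp [mul_assoc])
    (fun y => continuousOn_pi.2 fun i =>
      (continuousOn_finsetSum _ fun j _ => (hpc i j).mul continuousOn_const).add (hgc i)) c₀
  have hcont : ContinuousOn γ (Icc 0 2) := fun τ hτ => (hγ τ hτ).continuousWithinAt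
  have hexp : ∀ x : ℝ, 0 ≤ x → Real.exp (-x / 2) ∈ Ioc (0 : ℝ) 1 := fun x hx =>
    ⟨Real.exp_pos _, Real.exp_le_one_iff.2 (by linarith)⟩
  obtain ⟨M, hM⟩ := isCompact_Icc.exists_bound_of_continuousOn hcont
  refine ⟨fun x => γ (Real.exp (-x / 2)), ?_, ?_, M, ?_⟩
  · intro x hx i
    obtain ⟨h0, h1⟩ := hexp x hx
    have hd := (hγ (Real.exp (-x / 2)) ⟨h0.le, by linarith⟩).hasDerivAt
      (Icc_mem_nhds h0 (by linarith))
    have hd' : HasDerivAt (fun x : ℝ => Real.exp (-x / 2)) (Real.exp (-x / 2) * (-1 / 2)) x :=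
      (((hasDerivAt_id x).neg).div_const 2).exp
    refine ((hasDerivAt_pi.1 hd i).comp x hd').congr_deriv ?_
    simp only [hp, hg, Real.log_exp]
    rw [show -2 * (-x / 2) = x by ring]
    simp only [mul_assoc, ← Finset.mul_sum]
    field_simp
    ring
  · intro i
    have hcw : ContinuousWithinAt (fun τ => γ τ i) (Icc 0 2) 0 :=
      (continuousOn_pi.1 hcont i) 0 ⟨le_rfl, by norm_num⟩
    have ht := hcw.tendsto
    rw [hγ0] at ht
    refine ht.comp (tendsto_nhdsWithin_iff.2 ⟨?_, ?_⟩)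
    · exact Real.tendsto_exp_atBot.comp
        ((tendsto_neg_atTop_atBot).atBot_div_const (by norm_num : (0 : ℝ) < 2))
    · filter_upwards [eventually_ge_atTop 0] with x hx
      exact ⟨(hexp x hx).1.le, by linarith [(hexp x hx).2]⟩
  · intro x hx i
    obtain ⟨h0, h1⟩ := hexp x hx
    exact (norm_le_pi_norm _ i).trans (hM _ ⟨h0.le, by linarith⟩)

lemma abs_sub_le_of_abs_deriv_le_exp {c c' : ℝ → ℝ} {l K β : ℝ} (hβ : 0 < β)
    (hc : ∀ x, 0 ≤ x → HasDerivAt c (c' x) x) (hc' : ∀ x, 0 ≤ x → |c' x| ≤ K * Real.exp (-β * x))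
    (hl : Tendsto c atTop (𝓝 l)) {x : ℝ} (hx : 0 ≤ x) :
    |c x - l| ≤ K / β * Real.exp (-β * x) := by
  have hE : ∀ y, HasDerivAt (fun y => K / β * Real.exp (-β * y)) (-K * Real.exp (-β * y)) y := by
    intro y
    refine (((hasDerivAt_id y).const_mul (-β)).exp.const_mul (K / β)).congr_deriv ?_
    simp only [id]
    field_simp
  have tE : Tendsto (fun y => K / β * Real.exp (-β * y)) atTop (𝓝 0) := by
    have h : Tendsto (fun y => -β * y) atTop atBot :=
      tendsto_id.const_mul_atTop_of_neg (by linarith)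
    simpa using (Real.tendsto_exp_atBot.comp h).const_mul (K / β)
  have hanti : ∀ F F' : ℝ → ℝ, (∀ y, 0 ≤ y → HasDerivAt F (F' y) y) → (∀ y, 0 ≤ y → F' y ≤ 0) →
      Tendsto F atTop (𝓝 0) → 0 ≤ F x := by
    intro F F' hF hF' tF
    have ha : AntitoneOn F (Ici 0) := by
      refine antitoneOn_of_deriv_nonpos (convex_Ici 0)
        (fun y hy => (hF y hy).continuousAt.continuousWithinAt) ?_ ?_ <;>
        rw [interior_Ici] <;> intro y hy
      · exact (hF y (le_of_lt hy)).differentiableAt.differentiableWithinAt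
      · rw [(hF y (le_of_lt hy)).deriv]; exact hF' y (le_of_lt hy)
    refine le_of_tendsto tF ?_
    filter_upwards [eventually_ge_atTop x] with y hy using ha hx (hx.trans hy) hy
  have t0 : Tendsto (fun y => c y - l) atTop (𝓝 0) := by simpa using hl.sub_const l
  rw [abs_le]
  constructor
  · have := hanti (fun y => (c y - l) + K / β * Real.exp (-β * y)) _
      (fun y hy => ((hc y hy).sub_const l).add (hE y))
      (fun y hy => by linarith [(abs_le.1 (hc' y hy)).2]) (by simpa using t0.add tE)
    linarith
  · have := hanti (fun y => -(c y - l) + K / β * Real.exp (-β * y)) _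
      (fun y hy => ((hc y hy).sub_const l).neg.add (hE y))
      (fun y hy => by linarith [(abs_le.1 (hc' y hy)).1]) (by simpa using t0.neg.add tE)
    linarith

lemma Q_neg (x : ℝ) : Q (-x) = Q x := by
  rw [Q, Q, ← Real.cosh_neg]
  congr 5
  ring

lemma kink_neg (x : ℝ) : kink (-x) = -kink x := by
  rw [kink, kink, ← Real.tanh_neg]
  congr 1
  ring

lemma continuous_Q : Continuous Q :=
  continuous_iff_continuousAt.2 fun x => (hasDerivAt_Q x).continuousAt

lemma continuous_kink : Continuous kink :=
  continuous_iff_continuousAt.2 fun x => (hasDerivAt_kink x).continuousAt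

/-- `A = (A₀, A₁, A₂)` solves, on `s`, the first order system equivalent to
`A₀''' = A₀' + lam A₀ - 4 (Q³ A₀)' + g`. -/
structure SolvesOn (lam : ℝ) (g : ℝ → ℝ) (s : Set ℝ) (A : Fin 3 → ℝ → ℝ) : Prop where
  hasDeriv_zero : ∀ x ∈ s, HasDerivWithinAt (A 0) (A 1 x) s x
  hasDeriv_one : ∀ x ∈ s, HasDerivWithinAt (A 1) (A 2 x) s x
  hasDeriv_two : ∀ x ∈ s, HasDerivWithinAt (A 2) (A 1 x + lam * A 0 x
    + (-4 * Q x ^ 3 * A 1 x + 12 * kink x * Q x ^ 3 * A 0 x + g x)) s x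

lemma SolvesOn.add_smul {lam : ℝ} {g h : ℝ → ℝ} {s : Set ℝ} {A B : Fin 3 → ℝ → ℝ}
    (hA : SolvesOn lam g s A) (hB : SolvesOn lam h s B) (α : ℝ) :
    SolvesOn lam (g + α • h) s (A + α • B) where
  hasDeriv_zero x hx := (hA.hasDeriv_zero x hx).add ((hB.hasDeriv_zero x hx).const_smul α)
  hasDeriv_one x hx := (hA.hasDeriv_one x hx).add ((hB.hasDeriv_one x hx).const_smul α)
  hasDeriv_two x hx := by
    refine ((hA.hasDeriv_two x hx).add ((hB.hasDeriv_two x hx).const_smul α)).congr_deriv ?_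
    simp only [Pi.add_apply, Pi.smul_apply, smul_eq_mul]
    ring

lemma SolvesOn.reflect {lam : ℝ} {g : ℝ → ℝ} {A : Fin 3 → ℝ → ℝ} (hA : SolvesOn lam g (Ici 0) A) :
    SolvesOn (-lam) (fun x => -g (-x)) (Iic 0) (fun i x => (-1) ^ (i : ℕ) * A i (-x)) := by
  have key : ∀ {F : ℝ → ℝ} {F' x : ℝ}, x ∈ Iic (0 : ℝ) → HasDerivWithinAt F F' (Ici 0) (-x) →
      HasDerivWithinAt (fun y => F (-y)) (-F') (Iic 0) x := by
    intro F F' x hx hF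
    have h := hF.comp x (hasDerivWithinAt_id x (Iic 0)).neg (fun y hy => by
      simpa using hy)
    exact h.congr_deriv (by simp)
  have hmem : ∀ {x : ℝ}, x ∈ Iic (0 : ℝ) → -x ∈ Ici (0 : ℝ) := fun hx => by simpa using hx
  refine ⟨fun x hx => ?_, fun x hx => ?_, fun x hx => ?_⟩
  · exact ((key hx (hA.hasDeriv_zero _ (hmem hx))).const_mul _).congr_deriv (by simp)
  · exact ((key hx (hA.hasDeriv_one _ (hmem hx))).const_mul _).congr_deriv (by simp)
  · refine ((key hx (hA.hasDeriv_two _ (hmem hx))).const_mul _).congr_deriv ?_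
    rw [Q_neg, kink_neg]
    simp
    ring

lemma SolvesOn.glue {lam : ℝ} {g : ℝ → ℝ} {A B : Fin 3 → ℝ → ℝ} (hA : SolvesOn lam g (Iic 0) A)
    (hB : SolvesOn lam g (Ici 0) B) (h : ∀ i, A i 0 = B i 0) :
    ∃ C : Fin 3 → ℝ → ℝ, SolvesOn lam g univ C ∧ (∀ i, ∀ x ≤ 0, C i x = A i x) ∧
      ∀ i, ∀ x, 0 ≤ x → C i x = B i x := by
  set C : Fin 3 → ℝ → ℝ := fun i x => if x ≤ 0 then A i x else B i x with hC
  have hl : ∀ i, ∀ x ≤ 0, C i x = A i x := fun i x hx => if_pos hx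
  have hr : ∀ i, ∀ x, 0 ≤ x → C i x = B i x := fun i x hx => by
    rcases hx.eq_or_lt with rfl | hx
    · rw [hl i 0 le_rfl, h]
    · exact if_neg (not_le.2 hx)
  have key : ∀ {i : Fin 3} {D : ℝ} {x : ℝ},
      (x ≤ 0 → HasDerivWithinAt (A i) D (Iic 0) x) →
      (0 ≤ x → HasDerivWithinAt (B i) D (Ici 0) x) → HasDerivWithinAt (C i) D univ x := by
    intro i D x h1 h2
    have e1 : x ≤ 0 → HasDerivWithinAt (C i) D (Iic 0) x := fun hx =>
      (h1 hx).congr (fun y hy => hl i y hy) (hl i x hx)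
    have e2 : 0 ≤ x → HasDerivWithinAt (C i) D (Ici 0) x := fun hx =>
      (h2 hx).congr (fun y hy => hr i y hy) (hr i x hx)
    rcases lt_trichotomy x 0 with hx | rfl | hx
    · exact ((e1 hx.le).hasDerivAt (Iic_mem_nhds hx)).hasDerivWithinAt
    · rw [← Iic_union_Ici (a := (0 : ℝ))]
      exact (e1 le_rfl).union (e2 le_rfl)
    · exact ((e2 hx.le).hasDerivAt (Ici_mem_nhds hx)).hasDerivWithinAt
  refine ⟨C, ⟨fun x _ => ?_, fun x _ => ?_, fun x _ => ?_⟩, hl, hr⟩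
  · refine key (fun hx => ?_) (fun hx => ?_)
    · rw [hl 1 x hx]; exact hA.hasDeriv_zero x hx
    · rw [hr 1 x hx]; exact hB.hasDeriv_zero x hx
  · refine key (fun hx => ?_) (fun hx => ?_)
    · rw [hl 2 x hx]; exact hA.hasDeriv_one x hx
    · rw [hr 2 x hx]; exact hB.hasDeriv_one x hx
  · refine key (fun hx => ?_) (fun hx => ?_)
    · rw [hl 1 x hx, hl 0 x hx]; exact hA.hasDeriv_two x hx
    · rw [hr 1 x hx, hr 0 x hx]; exact hB.hasDeriv_two x hx

lemma exists_lagrange_weights {r : Fin 3 → ℝ} (hr : Function.Injective r) :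
    ∃ κ : Fin 3 → ℝ, ∑ i, κ i = 0 ∧ ∑ i, κ i * r i = 0 ∧ ∑ i, κ i * r i ^ 2 = 1 := by
  have h01 : r 0 - r 1 ≠ 0 := sub_ne_zero.2 (hr.ne (by decide))
  have h02 : r 0 - r 2 ≠ 0 := sub_ne_zero.2 (hr.ne (by decide))
  have h12 : r 1 - r 2 ≠ 0 := sub_ne_zero.2 (hr.ne (by decide))
  refine ⟨![1 / ((r 0 - r 1) * (r 0 - r 2)), -1 / ((r 0 - r 1) * (r 1 - r 2)),
    1 / ((r 0 - r 2) * (r 1 - r 2))], ?_, ?_, ?_⟩ <;>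
  · simp only [Fin.sum_univ_three, Matrix.cons_val]
    field_simp
    ring

/-- Solutions with prescribed asymptotic expansion along the exponentials `exp (r i * x)`, where
the `r i` are the characteristic exponents at infinity. -/
lemma exists_solvesOn_Ici {lam ρ K : ℝ} {r : Fin 3 → ℝ} (hinj : Function.Injective r)
    (hr : ∀ i, r i ^ 3 = r i + lam) (hρ : ∀ i, r i ≤ ρ) (hρ' : ∀ i, ρ ≤ r i + 2)
    {g : ℝ → ℝ} (hg : Continuous g) (hK : 0 ≤ K)
    (hgK : ∀ x, 0 ≤ x → |g x| ≤ K * Real.exp ((ρ - 3) * x)) (d : Fin 3 → ℝ) :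
    ∃ A : Fin 3 → ℝ → ℝ, SolvesOn lam g (Ici 0) A ∧
      ∃ M, ∀ k : Fin 3, ∀ x, 0 ≤ x →
        |A k x - ∑ i, r i ^ (k : ℕ) * d i * Real.exp (r i * x)| ≤ M * Real.exp ((ρ - 3) * x) := by
  obtain ⟨κ, hκ0, hκ1, hκ2⟩ := exists_lagrange_weights hinj
  set Kκ : ℝ := ∑ i, |κ i| with hKκ
  set Kr : ℝ := 1 + ∑ i, |r i| with hKr
  have hκi : ∀ i, |κ i| ≤ Kκ := fun i =>
    Finset.single_le_sum (f := fun i => |κ i|) (fun j _ => abs_nonneg _) (Finset.mem_univ i)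
  have hKκ0 : 0 ≤ Kκ := (abs_nonneg _).trans (hκi 0)
  have hri : ∀ i, |r i| ≤ Kr := fun i => by
    have := Finset.single_le_sum (f := fun i => |r i|) (fun j _ => abs_nonneg _)
      (Finset.mem_univ i)
    linarith
  have hKr1 : 1 ≤ Kr := by
    have : 0 ≤ ∑ i, |r i| := Finset.sum_nonneg fun j _ => abs_nonneg _
    linarith
  have hq : ∀ x, 0 ≤ x → Q x ^ 3 ≤ 10 * Real.exp (-3 * x) := fun x hx => by
    simpa [abs_of_nonneg hx] using Q_cube_le x
  have hQ3 : ∀ x, 0 ≤ Q x ^ 3 := fun x => (pow_pos (Q_pos x) 3).le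
  have hab : ∀ x, 0 ≤ x → ∀ y z m : ℝ, |y| ≤ m → |z| ≤ m →
      |-4 * Q x ^ 3 * y + 12 * kink x * Q x ^ 3 * z| ≤ 160 * m * Real.exp (-3 * x) := by
    intro x hx y z m hy hz
    have hm : 0 ≤ m := (abs_nonneg _).trans hy
    have hkz : |kink x * z| ≤ m := by
      rw [abs_mul]
      exact (mul_le_of_le_one_left (abs_nonneg _) (abs_kink_le_one x)).trans hz
    have h1 : |-4 * y + 12 * (kink x * z)| ≤ 16 * m := by
      rw [abs_le] at hy hkz ⊢
      constructor <;> linarith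
    rw [show -4 * Q x ^ 3 * y + 12 * kink x * Q x ^ 3 * z
      = Q x ^ 3 * (-4 * y + 12 * (kink x * z)) by ring, abs_mul, abs_of_nonneg (hQ3 x)]
    calc Q x ^ 3 * |-4 * y + 12 * (kink x * z)|
        ≤ (10 * Real.exp (-3 * x)) * (16 * m) :=
          mul_le_mul (hq x hx) h1 (abs_nonneg _) (by positivity)
      _ = _ := by ring
  set P : ℝ → Fin 3 → Fin 3 → ℝ := fun x i j => κ i * Real.exp (-r i * x)
    * ((-4 * Q x ^ 3 * r j + 12 * kink x * Q x ^ 3 * 1) * Real.exp (r j * x)) with hPdef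
  set f : ℝ → Fin 3 → ℝ := fun x i => κ i * Real.exp (-r i * x) * g x with hfdef
  have hcQ := continuous_Q
  have hck := continuous_kink
  obtain ⟨c, hc, hclim, M, hM⟩ := exists_linear_system_tendsto (P := P) (f := f)
    (K := Kκ * (160 * Kr + K)) (fun i j => by fun_prop) (fun i => by fun_prop)
    (fun i j x hx => by
      simp only [hPdef]
      rw [abs_mul, abs_mul, abs_mul, Real.abs_exp, Real.abs_exp]
      have h1 := hab x hx (r j) 1 Kr (hri j) (by simpa using hKr1)
      have h2 : Real.exp (-r i * x) * (Real.exp (-3 * x) * Real.exp (r j * x))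
          ≤ Real.exp (-x) := by
        rw [← Real.exp_add, ← Real.exp_add, Real.exp_le_exp]
        nlinarith [hρ j, hρ' i]
      calc |κ i| * Real.exp (-r i * x) * (|-4 * Q x ^ 3 * r j + 12 * kink x * Q x ^ 3 * 1|
            * Real.exp (r j * x))
          ≤ Kκ * Real.exp (-r i * x) * (160 * Kr * Real.exp (-3 * x) * Real.exp (r j * x)) := by
            gcongr
            exact hκi i
        _ = Kκ * (160 * Kr) * (Real.exp (-r i * x) * (Real.exp (-3 * x) * Real.exp (r j * x))) := by
            ring
        _ ≤ Kκ * (160 * Kr + K) * Real.exp (-x) := by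
            gcongr
            linarith)
    (fun i x hx => by
      simp only [hfdef]
      rw [abs_mul, abs_mul, Real.abs_exp]
      have h2 : Real.exp (-r i * x) * Real.exp ((ρ - 3) * x) ≤ Real.exp (-x) := by
        rw [← Real.exp_add, Real.exp_le_exp]
        nlinarith [hρ' i]
      calc |κ i| * Real.exp (-r i * x) * |g x|
          ≤ Kκ * Real.exp (-r i * x) * (K * Real.exp ((ρ - 3) * x)) := by
            gcongr
            · exact hκi i
            · exact hgK x hx
        _ = Kκ * K * (Real.exp (-r i * x) * Real.exp ((ρ - 3) * x)) := by ring
        _ ≤ Kκ * (160 * Kr + K) * Real.exp (-x) := by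
            gcongr
            linarith) d
  have hM0 : 0 ≤ M := (abs_nonneg _).trans (hM 0 le_rfl 0)
  set A : ℕ → ℝ → ℝ := fun k x => ∑ i, r i ^ k * c x i * Real.exp (r i * x) with hA
  set φ : ℝ → ℝ := fun x => -4 * Q x ^ 3 * A 1 x + 12 * kink x * Q x ^ 3 * A 0 x + g x with hφ
  have hc' : ∀ x, 0 ≤ x → ∀ i,
      HasDerivAt (fun y => c y i) (κ i * Real.exp (-r i * x) * φ x) x := by
    intro x hx i
    refine (hc x hx i).congr_deriv ?_
    simp only [hPdef, hfdef, hφ, hA, Fin.sum_univ_three]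
    ring
  have hA' : ∀ k x, 0 ≤ x → HasDerivAt (A k) (A (k + 1) x + (∑ i, κ i * r i ^ k) * φ x) x := by
    intro k x hx
    have hterm : ∀ i ∈ (Finset.univ : Finset (Fin 3)),
        HasDerivAt (fun y => r i ^ k * c y i * Real.exp (r i * y))
          (r i ^ (k + 1) * c x i * Real.exp (r i * x) + κ i * r i ^ k * φ x) x := by
      intro i _
      refine (((hc' x hx i).const_mul (r i ^ k)).mul
        (((hasDerivAt_id x).const_mul (r i)).exp)).congr_deriv ?_
      have he : Real.exp (-r i * x) * Real.exp (r i * x) = 1 := by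
        rw [← Real.exp_add]; simp
      simp only [id, mul_one]
      linear_combination (r i ^ k * κ i * φ x) * he
    refine (HasDerivAt.fun_sum hterm).congr_deriv ?_
    rw [Finset.sum_add_distrib, ← Finset.sum_mul]
  have hA3 : ∀ x, A 3 x = A 1 x + lam * A 0 x := by
    intro x
    simp only [hA, hr]
    rw [Finset.mul_sum, ← Finset.sum_add_distrib]
    exact Finset.sum_congr rfl fun i _ => by ring
  have hAbd : ∀ k, k ≤ 1 → ∀ x, 0 ≤ x → |A k x| ≤ 3 * (Kr * M) * Real.exp (ρ * x) := by
    intro k hk x hx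
    refine (Finset.abs_sum_le_sum_abs _ _).trans ?_
    have hterm : ∀ i ∈ (Finset.univ : Finset (Fin 3)),
        |r i ^ k * c x i * Real.exp (r i * x)| ≤ Kr * M * Real.exp (ρ * x) := by
      intro i _
      rw [abs_mul, abs_mul, Real.abs_exp]
      have h1 : |r i ^ k| ≤ Kr := by
        interval_cases k
        · simpa using hKr1
        · simpa using hri i
      gcongr
      · exact hM x hx i
      · exact hρ i
    refine (Finset.sum_le_sum hterm).trans ?_
    simp [mul_assoc]
  set Kφ : ℝ := 160 * (3 * (Kr * M)) + K with hKφ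
  have hKφ0 : 0 ≤ Kφ := by positivity
  have hφbd : ∀ x, 0 ≤ x → |φ x| ≤ Kφ * Real.exp ((ρ - 3) * x) := by
    intro x hx
    have h1 := hab x hx _ _ _ (hAbd 1 le_rfl x hx) (hAbd 0 zero_le_one x hx)
    have h2 : Real.exp (ρ * x) * Real.exp (-3 * x) = Real.exp ((ρ - 3) * x) := by
      rw [← Real.exp_add]; congr 1; ring
    refine (abs_add_le _ _).trans ((add_le_add h1 (hgK x hx)).trans (le_of_eq ?_))
    rw [hKφ, ← h2]
    ring
  have hcd : ∀ x, 0 ≤ x → ∀ i,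
      |c x i - d i| * Real.exp (r i * x) ≤ Kκ * Kφ * Real.exp ((ρ - 3) * x) := by
    intro x hx i
    have hβ : 1 ≤ r i + 3 - ρ := by linarith [hρ' i]
    have h := abs_sub_le_of_abs_deriv_le_exp (K := Kκ * Kφ) (β := r i + 3 - ρ) (by linarith)
      (fun y hy => hc' y hy i) (fun y hy => by
        rw [abs_mul, abs_mul, Real.abs_exp]
        have he : Real.exp (-(r i + 3 - ρ) * y)
            = Real.exp (-r i * y) * Real.exp ((ρ - 3) * y) := by
          rw [← Real.exp_add]; congr 1; ring
        calc |κ i| * Real.exp (-r i * y) * |φ y|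
            ≤ Kκ * Real.exp (-r i * y) * (Kφ * Real.exp ((ρ - 3) * y)) := by
              gcongr
              · exact hκi i
              · exact hφbd y hy
          _ = _ := by rw [he]; ring) (hclim i) hx
    have he : Real.exp (-(r i + 3 - ρ) * x) * Real.exp (r i * x) = Real.exp ((ρ - 3) * x) := by
      rw [← Real.exp_add]; congr 1; ring
    calc |c x i - d i| * Real.exp (r i * x)
        ≤ Kκ * Kφ / (r i + 3 - ρ) * Real.exp (-(r i + 3 - ρ) * x) * Real.exp (r i * x) := by
          gcongr
      _ = Kκ * Kφ / (r i + 3 - ρ) * Real.exp ((ρ - 3) * x) := by rw [mul_assoc, he]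
      _ ≤ Kκ * Kφ * Real.exp ((ρ - 3) * x) := by
          gcongr
          exact div_le_self (by positivity) hβ
  refine ⟨fun k => A k, ⟨fun x hx => ?_, fun x hx => ?_, fun x hx => ?_⟩,
    3 * (Kr ^ 2 * (Kκ * Kφ)), fun k x hx => ?_⟩
  · refine ((hA' 0 x hx).congr_deriv ?_).hasDerivWithinAt
    simp [hκ0]
  · refine ((hA' 1 x hx).congr_deriv ?_).hasDerivWithinAt
    simp [hκ1]
  · refine ((hA' 2 x hx).congr_deriv ?_).hasDerivWithinAt
    rw [hκ2, one_mul, hA3]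
    rfl
  · simp only [hA]
    rw [← Finset.sum_sub_distrib]
    refine (Finset.abs_sum_le_sum_abs _ _).trans ?_
    have hterm : ∀ i ∈ (Finset.univ : Finset (Fin 3)),
        |r i ^ (k : ℕ) * c x i * Real.exp (r i * x) - r i ^ (k : ℕ) * d i * Real.exp (r i * x)|
          ≤ Kr ^ 2 * (Kκ * Kφ) * Real.exp ((ρ - 3) * x) := by
      intro i _
      rw [show r i ^ (k : ℕ) * c x i * Real.exp (r i * x)
          - r i ^ (k : ℕ) * d i * Real.exp (r i * x)
          = r i ^ (k : ℕ) * ((c x i - d i) * Real.exp (r i * x)) by ring, abs_mul, abs_mul,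
        Real.abs_exp, mul_assoc, abs_pow]
      have h1 : |r i| ^ (k : ℕ) ≤ Kr ^ 2 :=
        (pow_le_pow_left₀ (abs_nonneg _) (hri i) _).trans
          (pow_le_pow_right₀ hKr1 (by omega))
      exact mul_le_mul h1 (hcd x hx i) (by positivity) (by positivity)
    refine (Finset.sum_le_sum hterm).trans ?_
    simp [mul_assoc]

lemma eq_zero_of_forall_abs_mul_exp_le {α M p q : ℝ} (hpq : p < q)
    (h : ∀ x, 0 ≤ x → |α * Real.exp (-p * x)| ≤ M * Real.exp (-q * x)) : α = 0 := by
  have hlim : Tendsto (fun x : ℝ => M * Real.exp (-((q - p) * x))) atTop (𝓝 (M * 0)) :=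
    (Real.tendsto_exp_neg_atTop_nhds_zero.comp
      (tendsto_id.const_mul_atTop (sub_pos.2 hpq))).const_mul M
  rw [mul_zero] at hlim
  have hle : |α| ≤ 0 := by
    refine ge_of_tendsto hlim ?_
    filter_upwards [eventually_ge_atTop 0] with x hx
    have h1 := h x hx
    rw [abs_mul, Real.abs_exp] at h1
    have h2 : Real.exp (-q * x) = Real.exp (-((q - p) * x)) * Real.exp (-p * x) := by
      rw [← Real.exp_add]; congr 1; ring
    rw [h2, ← mul_assoc] at h1
    exact le_of_mul_le_mul_right h1 (Real.exp_pos _)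
  exact abs_nonpos_iff.1 hle

lemma tendsto_zero_of_abs_le_exp {f : ℝ → ℝ} {M a b : ℝ} (ha : 0 < a) (hb : 0 < b)
    (hl : ∀ x ≤ 0, |f x| ≤ M * Real.exp (a * x))
    (hr : ∀ x, 0 ≤ x → |f x| ≤ M * Real.exp (-b * x)) : Tendsto f (cocompact ℝ) (𝓝 0) := by
  rw [cocompact_eq_atBot_atTop, tendsto_sup]
  constructor
  · have hlim : Tendsto (fun x : ℝ => M * Real.exp (a * x)) atBot (𝓝 (M * 0)) :=
      (Real.tendsto_exp_atBot.comp (tendsto_id.const_mul_atBot ha)).const_mul M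
    rw [mul_zero] at hlim
    refine squeeze_zero_norm' ?_ hlim
    filter_upwards [eventually_le_atBot 0] with x hx using hl x hx
  · have hlim : Tendsto (fun x : ℝ => M * Real.exp (-b * x)) atTop (𝓝 (M * 0)) :=
      (Real.tendsto_exp_atBot.comp
        (tendsto_id.const_mul_atTop_of_neg (neg_neg_of_pos hb))).const_mul M
    rw [mul_zero] at hlim
    refine squeeze_zero_norm' ?_ hlim
    filter_upwards [eventually_ge_atTop 0] with x hx using hr x hx

/-- The characteristic exponents `a`, `-b`, `-s` of `r³ = r + lam`, with the gaps used below. -/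
structure Exponents (lam a b s : ℝ) : Prop where
  lam_pos : 0 < lam
  b_pos : 0 < b
  b_lt_s : b < s
  s_lt : s < 3 / 2
  a_pos : 0 < a
  a_lt : a < 3 / 2
  add_le : a + s ≤ 2
  root_a : a ^ 3 = a + lam
  root_b : (-b) ^ 3 = -b + lam
  root_s : (-s) ^ 3 = -s + lam

lemma Exponents.exists_right {lam a b s K : ℝ} (he : Exponents lam a b s) {g : ℝ → ℝ}
    (hg : Continuous g) (hK : 0 ≤ K) (hgK : ∀ x, 0 ≤ x → |g x| ≤ K * Real.exp ((a - 3) * x))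
    (β γ : ℝ) :
    ∃ A : Fin 3 → ℝ → ℝ, SolvesOn lam g (Ici 0) A ∧ ∃ M, ∀ k : Fin 3, ∀ x, 0 ≤ x →
      |A k x - ((-b) ^ (k : ℕ) * β * Real.exp (-b * x) + (-s) ^ (k : ℕ) * γ * Real.exp (-s * x))|
        ≤ M * Real.exp (-(3 / 2) * x) := by
  obtain ⟨hlam, hb, hbs, hs, ha, ha', has, hra, hrb, hrs⟩ := he
  obtain ⟨A, hA, M, hM⟩ := exists_solvesOn_Ici (lam := lam) (ρ := a) (r := ![a, -b, -s])
    (by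
      intro i j hij
      fin_cases i <;> fin_cases j <;> simp at hij ⊢ <;> linarith)
    (fun i => by fin_cases i <;> simp [hra, hrb, hrs])
    (fun i => by fin_cases i <;> simp <;> linarith)
    (fun i => by fin_cases i <;> simp <;> linarith) hg hK hgK ![0, β, γ]
  have hM0 : 0 ≤ M := by
    simpa using (abs_nonneg _).trans (hM 0 0 le_rfl)
  refine ⟨A, hA, M, fun k x hx => ?_⟩
  have h := hM k x hx
  simp only [Fin.sum_univ_three, Matrix.cons_val, mul_zero, zero_mul, zero_add] at h
  refine h.trans ?_
  gcongr
  linarith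

lemma Exponents.exists_left {lam a b s K : ℝ} (he : Exponents lam a b s) {g : ℝ → ℝ}
    (hg : Continuous g) (hK : 0 ≤ K) (hgK : ∀ x ≤ 0, |g x| ≤ K * Real.exp ((3 - s) * x))
    (α : ℝ) :
    ∃ A : Fin 3 → ℝ → ℝ, SolvesOn lam g (Iic 0) A ∧ ∃ M, ∀ k : Fin 3, ∀ x ≤ 0,
      |A k x - a ^ (k : ℕ) * α * Real.exp (a * x)| ≤ M * Real.exp ((3 - s) * x) := by
  obtain ⟨hlam, hb, hbs, hs, ha, ha', has, hra, hrb, hrs⟩ := he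
  obtain ⟨A, hA, M, hM⟩ := exists_solvesOn_Ici (lam := -lam) (ρ := s) (r := ![-a, b, s])
    (by
      intro i j hij
      fin_cases i <;> fin_cases j <;> simp at hij ⊢ <;> linarith)
    (fun i => by
      fin_cases i <;> simp only [Fin.zero_eta, Fin.mk_one, Fin.reduceFinMk, Matrix.cons_val]
      · linear_combination -hra
      · linear_combination -hrb
      · linear_combination -hrs)
    (fun i => by fin_cases i <;> simp <;> linarith)
    (fun i => by fin_cases i <;> simp <;> linarith)
    (g := fun x => -g (-x)) (by fun_prop) hK
    (fun x hx => by
      rw [abs_neg]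
      refine (hgK (-x) (by linarith)).trans (le_of_eq ?_)
      congr 2; ring) ![α, 0, 0]
  refine ⟨fun i x => (-1) ^ (i : ℕ) * A i (-x), ?_, M, fun k x hx => ?_⟩
  · have h := hA.reflect
    simpa using h
  · have h := hM k (-x) (by linarith)
    simp only [Fin.sum_univ_three, Matrix.cons_val, mul_zero, zero_mul, add_zero] at h
    rw [show (-1 : ℝ) ^ (k : ℕ) * A k (-x) - a ^ (k : ℕ) * α * Real.exp (a * x)
      = (-1) ^ (k : ℕ) * (A k (-x) - (-a) ^ (k : ℕ) * α * Real.exp (-a * -x)) by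
        rw [show -a = (-1) * a by ring, mul_pow, show -1 * a * -x = a * x by ring]
        have h1 : (-1 : ℝ) ^ (k : ℕ) * (-1 : ℝ) ^ (k : ℕ) = 1 := by
          rw [← mul_pow]; simp
        linear_combination (a ^ (k : ℕ) * α * Real.exp (a * x)) * h1, abs_mul, abs_pow,
      abs_neg, abs_one, one_pow, one_mul]
    refine h.trans (le_of_eq ?_)
    congr 2; ring

/-- There is a global solution decaying at both ends. -/
lemma Exponents.exists_global {lam a b s K : ℝ} (he : Exponents lam a b s) {g : ℝ → ℝ}
    (hg : Continuous g) (hK : 0 ≤ K) (hgr : ∀ x, 0 ≤ x → |g x| ≤ K * Real.exp ((a - 3) * x))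
    (hgl : ∀ x ≤ 0, |g x| ≤ K * Real.exp ((3 - s) * x)) :
    ∃ (A : Fin 3 → ℝ → ℝ) (β γ M : ℝ), SolvesOn lam g univ A ∧
      (∀ k, ∀ x ≤ 0, |A k x| ≤ M * Real.exp (a * x)) ∧
      ∀ k : Fin 3, ∀ x, 0 ≤ x →
      |A k x - ((-b) ^ (k : ℕ) * β * Real.exp (-b * x) + (-s) ^ (k : ℕ) * γ * Real.exp (-s * x))|
        ≤ M * Real.exp (-(3 / 2) * x) := by
  have hz : Continuous (0 : ℝ → ℝ) := continuous_const
  obtain ⟨p, hp, Mp, hMp⟩ := he.exists_right hg hK hgr 0 0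
  obtain ⟨φ, hφ, Mφ, hMφ⟩ := he.exists_right hz le_rfl (fun x _ => by simp) 1 0
  obtain ⟨ψ, hψ, Mψ, hMψ⟩ := he.exists_right hz le_rfl (fun x _ => by simp) 0 1
  obtain ⟨q, hq, Mq, hMq⟩ := he.exists_left hg hK hgl 0
  obtain ⟨χ, hχ, Mχ, hMχ⟩ := he.exists_left hz le_rfl (fun x _ => by simp) 1
  obtain ⟨hlam, hb, hbs, hs, ha, ha', has, hra, hrb, hrs⟩ := he
  have hMp0 : 0 ≤ Mp := by simpa using (abs_nonneg _).trans (hMp 0 0 le_rfl)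
  have hMφ0 : 0 ≤ Mφ := by simpa using (abs_nonneg _).trans (hMφ 0 0 le_rfl)
  have hMψ0 : 0 ≤ Mψ := by simpa using (abs_nonneg _).trans (hMψ 0 0 le_rfl)
  have hMq0 : 0 ≤ Mq := by simpa using (abs_nonneg _).trans (hMq 0 0 le_rfl)
  have hMχ0 : 0 ≤ Mχ := by simpa using (abs_nonneg _).trans (hMχ 0 0 le_rfl)
  have hright : ∀ (ε β γ : ℝ) (k : Fin 3) (x : ℝ), 0 ≤ x →
      |(ε • p + β • φ + γ • ψ) k x
        - ((-b) ^ (k : ℕ) * β * Real.exp (-b * x) + (-s) ^ (k : ℕ) * γ * Real.exp (-s * x))|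
        ≤ (|ε| * Mp + |β| * Mφ + |γ| * Mψ) * Real.exp (-(3 / 2) * x) := by
    intro ε β γ k x hx
    have h1 := mul_le_mul_of_nonneg_left (hMp k x hx) (abs_nonneg ε)
    have h2 := mul_le_mul_of_nonneg_left (hMφ k x hx) (abs_nonneg β)
    have h3 := mul_le_mul_of_nonneg_left (hMψ k x hx) (abs_nonneg γ)
    rw [← abs_mul] at h1 h2 h3
    refine le_trans (le_of_eq ?_) ((abs_add_three _ _ _).trans
      ((add_le_add (add_le_add h1 h2) h3).trans (le_of_eq ?_)))
    · congr 1
      simp only [Pi.add_apply, Pi.smul_apply, smul_eq_mul]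
      ring
    · ring
  have hleft : ∀ (ε α : ℝ) (k : Fin 3) (x : ℝ), x ≤ 0 →
      |(ε • q + α • χ) k x - a ^ (k : ℕ) * α * Real.exp (a * x)|
        ≤ (|ε| * Mq + |α| * Mχ) * Real.exp ((3 - s) * x) := by
    intro ε α k x hx
    have h1 := mul_le_mul_of_nonneg_left (hMq k x hx) (abs_nonneg ε)
    have h2 := mul_le_mul_of_nonneg_left (hMχ k x hx) (abs_nonneg α)
    rw [← abs_mul] at h1 h2
    refine le_trans (le_of_eq ?_) ((abs_add_le _ _).trans
      ((add_le_add h1 h2).trans (le_of_eq ?_)))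
    · congr 1
      simp only [Pi.add_apply, Pi.smul_apply, smul_eq_mul]
      ring
    · ring
  have hleft' : ∀ (ε α : ℝ) (k : Fin 3) (x : ℝ), x ≤ 0 → |(ε • q + α • χ) k x|
        ≤ (|ε| * Mq + |α| * Mχ + (1 + a) ^ 2 * |α|) * Real.exp (a * x) := by
    intro ε α k x hx
    have h1 := hleft ε α k x hx
    have h2 : Real.exp ((3 - s) * x) ≤ Real.exp (a * x) := by
      rw [Real.exp_le_exp]; nlinarith
    have h3 : |a ^ (k : ℕ) * α * Real.exp (a * x)| ≤ (1 + a) ^ 2 * |α| * Real.exp (a * x) := by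
      rw [abs_mul, abs_mul, Real.abs_exp, abs_pow, abs_of_pos ha]
      have : a ^ (k : ℕ) ≤ (1 + a) ^ 2 :=
        (pow_le_pow_left₀ ha.le (by linarith) _).trans
          (pow_le_pow_right₀ (by linarith) (by omega))
      gcongr
    have h4 : (|ε| * Mq + |α| * Mχ) * Real.exp ((3 - s) * x)
        ≤ (|ε| * Mq + |α| * Mχ) * Real.exp (a * x) := by gcongr
    have h5 := abs_sub_abs_le_abs_sub ((ε • q + α • χ) k x) (a ^ (k : ℕ) * α * Real.exp (a * x))
    linarith
  have hright' : ∀ (β γ M : ℝ) (k : Fin 3) (x y : ℝ), 0 ≤ x → 0 ≤ M →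
      |y - ((-b) ^ (k : ℕ) * β * Real.exp (-b * x) + (-s) ^ (k : ℕ) * γ * Real.exp (-s * x))|
        ≤ M * Real.exp (-(3 / 2) * x) →
      |y| ≤ (M + (1 + s) ^ 2 * |β| + (1 + s) ^ 2 * |γ|) * Real.exp (-b * x) := by
    intro β γ M k x y hx hM h1
    have hpw : ∀ t, 0 < t → t ≤ s → |(-t) ^ (k : ℕ)| ≤ (1 + s) ^ 2 := fun t ht hts => by
      rw [abs_pow, abs_neg, abs_of_pos ht]
      exact (pow_le_pow_left₀ ht.le (by linarith) _).trans
          (pow_le_pow_right₀ (by linarith) (by omega))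
    have h2 : |(-b) ^ (k : ℕ) * β * Real.exp (-b * x)|
        ≤ (1 + s) ^ 2 * |β| * Real.exp (-b * x) := by
      rw [abs_mul, abs_mul, Real.abs_exp]
      gcongr
      exact hpw b hb hbs.le
    have h3 : |(-s) ^ (k : ℕ) * γ * Real.exp (-s * x)|
        ≤ (1 + s) ^ 2 * |γ| * Real.exp (-b * x) := by
      rw [abs_mul, abs_mul, Real.abs_exp]
      gcongr
      exact hpw s (by linarith) le_rfl
    have h4 : M * Real.exp (-(3 / 2) * x) ≤ M * Real.exp (-b * x) := by
      gcongr
      linarith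
    have h5 := abs_sub_abs_le_abs_sub y
      ((-b) ^ (k : ℕ) * β * Real.exp (-b * x) + (-s) ^ (k : ℕ) * γ * Real.exp (-s * x))
    have h6 := abs_add_le ((-b) ^ (k : ℕ) * β * Real.exp (-b * x))
      ((-s) ^ (k : ℕ) * γ * Real.exp (-s * x))
    linarith
  set T : (Fin 3 → ℝ) →ₗ[ℝ] (Fin 3 → ℝ) := Fintype.linearCombination ℝ
    ![fun i => χ i 0, fun i => -φ i 0, fun i => -ψ i 0] with hT
  have hTapp : ∀ v i, T v i = v 0 * χ i 0 - v 1 * φ i 0 - v 2 * ψ i 0 := by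
    intro v i
    simp [hT, Fintype.linearCombination_apply, Fin.sum_univ_three]
    ring
  have hinj : Function.Injective T := by
    rw [← LinearMap.ker_eq_bot, LinearMap.ker_eq_bot']
    intro v hv
    have h0 : SolvesOn lam 0 (Iic 0) ((0 : ℝ) • q + v 0 • χ) := by
      have h := (hχ.add_smul hχ (v 0 - 1))
      convert h using 1
      · simp
      · rw [zero_smul, zero_add, sub_smul, one_smul]; abel
    have h1 : SolvesOn lam 0 (Ici 0) ((0 : ℝ) • p + v 1 • φ + v 2 • ψ) := by
      have h := (hφ.add_smul hφ (v 1 - 1)).add_smul hψ (v 2)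
      convert h using 1
      · simp
      · rw [zero_smul, zero_add, sub_smul, one_smul]; abel
    obtain ⟨C, hC, hCl, hCr⟩ := h0.glue h1 (fun i => by
      have := hTapp v i
      rw [hv] at this
      simp only [Pi.zero_apply] at this
      simp only [Pi.add_apply, Pi.smul_apply, smul_eq_mul]
      linarith)
    have htend : ∀ k, Tendsto (C k) (cocompact ℝ) (𝓝 0) := by
      intro k
      refine tendsto_zero_of_abs_le_exp (M := max (|0| * Mq + |v 0| * Mχ + (1 + a) ^ 2 * |v 0|)
        (|0| * Mp + |v 1| * Mφ + |v 2| * Mψ + (1 + s) ^ 2 * |v 1| + (1 + s) ^ 2 * |v 2|))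
        ha hb (fun x hx => ?_) (fun x hx => ?_)
      · rw [hCl k x hx]
        refine (hleft' 0 (v 0) k x hx).trans ?_
        gcongr
        exact le_max_left _ _
      · rw [hCr k x hx]
        refine (hright' _ _ _ k x _ hx (by positivity) (hright 0 (v 1) (v 2) k x hx)).trans ?_
        gcongr
        exact le_max_right _ _
    have hC0 : ∀ x, C 0 x = 0 := fun x => eq_zero_of_linearized_eigenfunction hlam
      (fun x => hasDerivWithinAt_univ.1 (hC.hasDeriv_zero x trivial))
      (fun x => hasDerivWithinAt_univ.1 (hC.hasDeriv_one x trivial))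
      (fun x => (hasDerivWithinAt_univ.1 (hC.hasDeriv_two x trivial)).congr_deriv (by simp))
      (htend 0) (htend 1) (htend 2) x
    have hv0 : v 0 = 0 := by
      refine eq_zero_of_forall_abs_mul_exp_le (p := a) (q := 3 - s)
        (M := |0| * Mq + |v 0| * Mχ) (by linarith) fun x hx => ?_
      have h := hleft 0 (v 0) 0 (-x) (by linarith)
      rw [← hCl 0 (-x) (by linarith), hC0] at h
      simpa [mul_neg, ← neg_mul] using h
    have hR : ∀ x, 0 ≤ x → |v 1 * Real.exp (-b * x) + v 2 * Real.exp (-s * x)|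
        ≤ (|0| * Mp + |v 1| * Mφ + |v 2| * Mψ) * Real.exp (-(3 / 2) * x) := by
      intro x hx
      have h := hright 0 (v 1) (v 2) 0 x hx
      rw [← hCr 0 x hx, hC0, zero_sub, abs_neg] at h
      simpa using h
    have hv1 : v 1 = 0 := by
      refine eq_zero_of_forall_abs_mul_exp_le (p := b) (q := s)
        (M := |0| * Mp + |v 1| * Mφ + |v 2| * Mψ + |v 2|) hbs fun x hx => ?_
      have h1 := hR x hx
      have h2 : (|0| * Mp + |v 1| * Mφ + |v 2| * Mψ) * Real.exp (-(3 / 2) * x)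
          ≤ (|0| * Mp + |v 1| * Mφ + |v 2| * Mψ) * Real.exp (-s * x) := by
        gcongr
      have h3 := abs_sub_abs_le_abs_sub (v 1 * Real.exp (-b * x)) (-(v 2 * Real.exp (-s * x)))
      rw [sub_neg_eq_add, abs_neg, abs_mul (v 2), Real.abs_exp] at h3
      rw [add_mul _ |v 2|]
      exact sub_le_iff_le_add.1 (h3.trans (h1.trans h2))
    have hv2 : v 2 = 0 := by
      refine eq_zero_of_forall_abs_mul_exp_le (p := s) (q := 3 / 2)
        (M := |0| * Mp + |v 1| * Mφ + |v 2| * Mψ) hs fun x hx => ?_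
      have h1 := hR x hx
      rw [hv1] at h1 ⊢
      simpa using h1
    ext i
    fin_cases i
    · exact hv0
    · exact hv1
    · exact hv2
  obtain ⟨v, hv⟩ := (LinearMap.injective_iff_surjective.1 hinj) (fun i => p i 0 - q i 0)
  have h0 : SolvesOn lam g (Iic 0) ((1 : ℝ) • q + v 0 • χ) := by
    convert hq.add_smul hχ (v 0) using 1
    · simp
    · simp
  have h1 : SolvesOn lam g (Ici 0) ((1 : ℝ) • p + v 1 • φ + v 2 • ψ) := by
    convert (hp.add_smul hφ (v 1)).add_smul hψ (v 2) using 1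
    · simp
    · simp
  obtain ⟨C, hC, hCl, hCr⟩ := h0.glue h1 (fun i => by
    have := hTapp v i
    rw [hv] at this
    simp only [Pi.add_apply, Pi.smul_apply, smul_eq_mul]
    linarith)
  refine ⟨C, v 1, v 2, max (|1| * Mq + |v 0| * Mχ + (1 + a) ^ 2 * |v 0|)
    (|1| * Mp + |v 1| * Mφ + |v 2| * Mψ), hC, fun k x hx => ?_, fun k x hx => ?_⟩
  · rw [hCl k x hx]
    refine (hleft' 1 (v 0) k x hx).trans ?_
    gcongr
    exact le_max_left _ _
  · rw [hCr k x hx]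
    refine (hright 1 (v 1) (v 2) k x hx).trans ?_
    gcongr
    exact le_max_right _ _

lemma contDiff_of_hasDerivAt {n : ℕ} {f f' : ℝ → ℝ} (h : ∀ x, HasDerivAt f (f' x) x)
    (hf' : ContDiff ℝ n f') : ContDiff ℝ (n + 1 : ℕ) f := by
  have hd : deriv f = f' := funext fun x => (h x).deriv
  push_cast
  rw [contDiff_succ_iff_deriv, hd]
  exact ⟨fun x => (h x).differentiableAt, by simp, hf'⟩

lemma contDiff_kink : ContDiff ℝ (⊤ : ℕ∞) kink := by
  rw [contDiff_infty]
  intro n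
  induction n with
  | zero => exact contDiff_zero.2 continuous_kink
  | succ n ih =>
    refine contDiff_of_hasDerivAt hasDerivAt_kink ?_
    fun_prop

lemma contDiff_Q_cube : ContDiff ℝ (⊤ : ℕ∞) (fun x => Q x ^ 3) := by
  have h := contDiff_kink
  simp only [Q_cube]
  fun_prop

lemma SolvesOn.contDiff {lam : ℝ} {g : ℝ → ℝ} {A : Fin 3 → ℝ → ℝ} (hA : SolvesOn lam g univ A)
    (hg : ContDiff ℝ (⊤ : ℕ∞) g) (i : Fin 3) : ContDiff ℝ (⊤ : ℕ∞) (A i) := by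
  have h0 := fun x => hasDerivWithinAt_univ.1 (hA.hasDeriv_zero x trivial)
  have h1 := fun x => hasDerivWithinAt_univ.1 (hA.hasDeriv_one x trivial)
  have h2 := fun x => hasDerivWithinAt_univ.1 (hA.hasDeriv_two x trivial)
  have key : ∀ n : ℕ, ContDiff ℝ n (A 0) ∧ ContDiff ℝ n (A 1) ∧ ContDiff ℝ n (A 2) := by
    intro n
    induction n with
    | zero =>
      exact ⟨contDiff_zero.2 (continuous_iff_continuousAt.2 fun x => (h0 x).continuousAt),
        contDiff_zero.2 (continuous_iff_continuousAt.2 fun x => (h1 x).continuousAt),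
        contDiff_zero.2 (continuous_iff_continuousAt.2 fun x => (h2 x).continuousAt)⟩
    | succ n ih =>
      obtain ⟨i0, i1, i2⟩ := ih
      refine ⟨contDiff_of_hasDerivAt h0 i1, contDiff_of_hasDerivAt h1 i2,
        contDiff_of_hasDerivAt h2 ?_⟩
      have hk : ContDiff ℝ n kink := contDiff_infty.1 contDiff_kink n
      have hQ : ContDiff ℝ n (fun x => Q x ^ 3) := contDiff_infty.1 contDiff_Q_cube n
      have hg' : ContDiff ℝ n g := contDiff_infty.1 hg n
      exact (i1.add (contDiff_const.mul i0)).add ((((contDiff_const.mul hQ).mul i1).add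
        (((contDiff_const.mul hk).mul hQ).mul i0)).add hg')
  rw [contDiff_infty]
  intro n
  fin_cases i
  · exact (key n).1
  · exact (key n).2.1
  · exact (key n).2.2

/-- `f` is smooth and its derivatives up to order `n` are `O(exp (p * x))` on `s`. -/
def ExpBound (s : Set ℝ) (p : ℝ) (n : ℕ) (f : ℝ → ℝ) : Prop :=
  ContDiff ℝ (⊤ : ℕ∞) f ∧ ∀ k ≤ n, ∃ C, ∀ x ∈ s, |iteratedDeriv k f x| ≤ C * Real.exp (p * x)

namespace ExpBound

variable {s : Set ℝ} {p q : ℝ} {n : ℕ} {f g : ℝ → ℝ}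

lemma exists_nonneg (hf : ExpBound s p n f) {k : ℕ} (hk : k ≤ n) :
    ∃ C, 0 ≤ C ∧ ∀ x ∈ s, |iteratedDeriv k f x| ≤ C * Real.exp (p * x) := by
  obtain ⟨C, hC⟩ := hf.2 k hk
  exact ⟨|C|, abs_nonneg C, fun x hx => (hC x hx).trans
    (mul_le_mul_of_nonneg_right (le_abs_self C) (Real.exp_pos _).le)⟩

lemma contDiffAt (hf : ExpBound s p n f) (k : ℕ) (x : ℝ) : ContDiffAt ℝ k f x :=
  (contDiff_infty.1 hf.1 k).contDiffAt

lemma mono (hf : ExpBound s p n f) (h : ∀ x ∈ s, p * x ≤ q * x) : ExpBound s q n f := by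
  refine ⟨hf.1, fun k hk => ?_⟩
  obtain ⟨C, hC0, hC⟩ := hf.exists_nonneg hk
  exact ⟨C, fun x hx => (hC x hx).trans
    (mul_le_mul_of_nonneg_left (Real.exp_le_exp.2 (h x hx)) hC0)⟩

lemma add (hf : ExpBound s p n f) (hg : ExpBound s p n g) :
    ExpBound s p n (fun x => f x + g x) := by
  refine ⟨hf.1.add hg.1, fun k hk => ?_⟩
  obtain ⟨C, hC⟩ := hf.2 k hk
  obtain ⟨D, hD⟩ := hg.2 k hk
  refine ⟨C + D, fun x hx => ?_⟩
  rw [iteratedDeriv_fun_add (hf.contDiffAt k x) (hg.contDiffAt k x), add_mul]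
  exact (abs_add_le _ _).trans (add_le_add (hC x hx) (hD x hx))

lemma mul (hf : ExpBound s p n f) (hg : ExpBound s q n g) :
    ExpBound s (p + q) n (fun x => f x * g x) := by
  refine ⟨hf.1.mul hg.1, fun k hk => ?_⟩
  have hf' : ∀ i, ∃ C, 0 ≤ C ∧ (i ≤ n → ∀ x ∈ s, |iteratedDeriv i f x| ≤ C * Real.exp (p * x)) :=
    fun i => by
      by_cases hi : i ≤ n
      · obtain ⟨C, h0, hC⟩ := hf.exists_nonneg hi
        exact ⟨C, h0, fun _ => hC⟩
      · exact ⟨0, le_rfl, fun h => absurd h hi⟩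
  have hg' : ∀ i, ∃ C, i ≤ n → ∀ x ∈ s, |iteratedDeriv i g x| ≤ C * Real.exp (q * x) :=
    fun i => by
      by_cases hi : i ≤ n
      · obtain ⟨C, hC⟩ := hg.2 i hi
        exact ⟨C, fun _ => hC⟩
      · exact ⟨0, fun h => absurd h hi⟩
  choose C hC0 hC using hf'
  choose D hD using hg'
  refine ⟨∑ i ∈ Finset.range (k + 1), (k.choose i : ℝ) * (C i * D (k - i)), fun x hx => ?_⟩
  change |iteratedDeriv k (f * g) x| ≤ _
  rw [iteratedDeriv_mul (hf.contDiffAt k x) (hg.contDiffAt k x), Finset.sum_mul]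
  refine (Finset.abs_sum_le_sum_abs _ _).trans (Finset.sum_le_sum fun i hi => ?_)
  have hik : i ≤ k := by simpa [Nat.lt_succ_iff] using hi
  rw [abs_mul, abs_mul, Nat.abs_cast, add_mul, Real.exp_add]
  calc (k.choose i : ℝ) * |iteratedDeriv i f x| * |iteratedDeriv (k - i) g x|
      ≤ (k.choose i : ℝ) * (C i * Real.exp (p * x)) * (D (k - i) * Real.exp (q * x)) := by
        have := hC0 i
        gcongr
        · exact hC i (hik.trans hk) x hx
        · exact hD _ ((Nat.sub_le _ _).trans hk) x hx
    _ = _ := by ring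

lemma const (c : ℝ) : ExpBound s 0 n (fun _ => c) := by
  refine ⟨contDiff_const, fun k _ => ⟨|c|, fun x _ => ?_⟩⟩
  rw [iteratedDeriv_const]
  split_ifs <;> simp

lemma const_mul (c : ℝ) (hf : ExpBound s p n f) : ExpBound s p n (fun x => c * f x) := by
  simpa using (const c).mul hf

lemma zero (hf : ContDiff ℝ (⊤ : ℕ∞) f) {C : ℝ} (h : ∀ x ∈ s, |f x| ≤ C * Real.exp (p * x)) :
    ExpBound s p 0 f :=
  ⟨hf, fun k hk => ⟨C, by simpa [Nat.le_zero.1 hk] using h⟩⟩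

lemma succ {f' : ℝ → ℝ} (hf : ExpBound s p n f) (hd : ∀ x, HasDerivAt f (f' x) x)
    (hf' : ExpBound s p n f') : ExpBound s p (n + 1) f := by
  have hd' : deriv f = f' := funext fun x => (hd x).deriv
  refine ⟨hf.1, fun k hk => ?_⟩
  cases k with
  | zero => exact hf.2 0 (Nat.zero_le _)
  | succ k =>
    rw [iteratedDeriv_succ', hd']
    exact hf'.2 k (by omega)

lemma exp (p : ℝ) : ExpBound s p n (fun x => Real.exp (p * x)) := by
  induction n with
  | zero => exact zero (by fun_prop) (C := 1) fun x _ => by simp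
  | succ n ih =>
    refine ih.succ (fun x => ?_) (ih.const_mul p)
    exact (((hasDerivAt_id x).const_mul p).exp).congr_deriv (by simp [mul_comm])

lemma kink : ExpBound s 0 n _root_.kink := by
  induction n with
  | zero => exact zero contDiff_kink (C := 1) fun x _ => by simpa using abs_kink_le_one x
  | succ n ih =>
    refine ih.succ hasDerivAt_kink ?_
    have h := ((const 1).add ((ih.mul ih).mono (q := 0) (by simp) |>.const_mul (-1))).const_mul
      (3 / 2)
    convert h using 2
    ring

lemma Q_cube (hs : ∀ x ∈ s, -3 * |x| ≤ p * x) : ExpBound s p n (fun x => Q x ^ 3) := by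
  induction n with
  | zero =>
    refine zero contDiff_Q_cube (C := 10) fun x hx => ?_
    rw [abs_of_pos (pow_pos (Q_pos x) 3)]
    exact (Q_cube_le x).trans
      (mul_le_mul_of_nonneg_left (Real.exp_le_exp.2 (hs x hx)) (by norm_num))
  | succ n ih =>
    refine ih.succ hasDerivAt_Q_cube ?_
    have h := (kink.mul ih).const_mul (-3)
    rw [zero_add] at h
    convert h using 2
    ring

/-- Bounds on a solution of a third order equation propagate to all derivatives. -/
lemma of_system {F₀ F₁ F₂ F₃ : ℝ → ℝ} (h₀ : ExpBound s p 0 F₀) (h₁ : ExpBound s p 0 F₁)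
    (h₂ : ExpBound s p 0 F₂) (d₀ : ∀ x, HasDerivAt F₀ (F₁ x) x)
    (d₁ : ∀ x, HasDerivAt F₁ (F₂ x) x) (d₂ : ∀ x, HasDerivAt F₂ (F₃ x) x)
    (h : ∀ n, ExpBound s p n F₀ → ExpBound s p n F₁ → ExpBound s p n F₃) (n : ℕ) :
    ExpBound s p n F₀ ∧ ExpBound s p n F₁ ∧ ExpBound s p n F₂ := by
  induction n with
  | zero => exact ⟨h₀, h₁, h₂⟩
  | succ n ih =>
    exact ⟨ih.1.succ d₀ ih.2.1, ih.2.1.succ d₁ ih.2.2, ih.2.2.succ d₂ (h n ih.1 ih.2.1)⟩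

end ExpBound

lemma tendsto_zero_of_integrable_sq {f f' : ℝ → ℝ} (hd : ∀ x, HasDerivAt f (f' x) x)
    (hf' : Continuous f') (h : Integrable (fun x => f x ^ 2))
    (h' : Integrable (fun x => f' x ^ 2)) :
    Tendsto f (cocompact ℝ) (𝓝 0) := by
  have hf : Continuous f := continuous_iff_continuousAt.2 fun x => (hd x).continuousAt
  have hd2 : ∀ x, HasDerivAt (fun y => f y ^ 2) (2 * f x * f' x) x := fun x =>
    ((hd x).fun_pow 2).congr_deriv (by simp)
  have hff' : Integrable (fun x => 2 * f x * f' x) := by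
    refine (h.add h').mono' (by fun_prop) (Eventually.of_forall fun x => ?_)
    rw [Real.norm_eq_abs, abs_le]
    simp only [Pi.add_apply]
    constructor <;> nlinarith [sq_nonneg (f x + f' x), sq_nonneg (f x - f' x)]
  have hlim : Tendsto (fun x => f x ^ 2) (cocompact ℝ) (𝓝 0) := by
    rw [cocompact_eq_atBot_atTop, tendsto_sup]
    exact ⟨tendsto_zero_of_hasDerivAt_of_integrableOn_Iic (a := 0) (fun x _ => hd2 x)
      hff'.integrableOn h.integrableOn,
      tendsto_zero_of_hasDerivAt_of_integrableOn_Ioi (a := 0) (fun x _ => hd2 x)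
      hff'.integrableOn h.integrableOn⟩
  rw [tendsto_zero_iff_abs_tendsto_zero]
  simpa [Real.sqrt_sq_eq_abs, Function.comp_def] using hlim.sqrt

lemma integrable_sq_of_abs_le_exp {f : ℝ → ℝ} (hf : Continuous f) {C p q : ℝ} (hp : 0 < p)
    (hq : 0 < q) (hl : ∀ x < 0, |f x| ≤ C * Real.exp (p * x))
    (hr : ∀ x, 0 < x → |f x| ≤ C * Real.exp (-q * x)) : Integrable (fun x => f x ^ 2) := by
  have key : ∀ {x t : ℝ}, |f x| ≤ C * Real.exp (t * x) →
      ‖f x ^ 2‖ ≤ C ^ 2 * Real.exp (2 * t * x) := by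
    intro x t h
    rw [Real.norm_eq_abs, abs_pow, show 2 * t * x = t * x + t * x by ring, Real.exp_add]
    calc |f x| ^ 2 ≤ (C * Real.exp (t * x)) ^ 2 := pow_le_pow_left₀ (abs_nonneg _) h 2
      _ = _ := by ring
  rw [← integrableOn_univ, ← Iio_union_Ici (a := (0 : ℝ)), integrableOn_union,
    integrableOn_Ici_iff_integrableOn_Ioi]
  constructor
  · refine Integrable.mono' (g := fun x => C ^ 2 * Real.exp (2 * p * x))
      (((integrableOn_exp_mul_Iic (by linarith) 0).mono_set Iio_subset_Iic_self).const_mul _)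
      (by fun_prop) ?_
    exact (ae_restrict_iff' measurableSet_Iio).2 (Eventually.of_forall fun x hx => key (hl x hx))
  · refine Integrable.mono' (g := fun x => C ^ 2 * Real.exp (2 * -q * x))
      ((integrableOn_exp_mul_Ioi (by linarith) 0).const_mul _) (by fun_prop) ?_
    exact (ae_restrict_iff' measurableSet_Ioi).2 (Eventually.of_forall fun x hx => key (hr x hx))

/-- Minus the derivative of `exp (-s x) Q³`. -/
noncomputable def source (s x : ℝ) : ℝ := (s + 3 * kink x) * (Real.exp (-s * x) * Q x ^ 3)

lemma hasDerivAt_exp_mul_Q_cube (s x : ℝ) :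
    HasDerivAt (fun y => Real.exp (-s * y) * Q y ^ 3) (-source s x) x := by
  refine ((((hasDerivAt_id x).const_mul (-s)).exp).mul (hasDerivAt_Q_cube x)).congr_deriv ?_
  simp only [source, id]
  ring

lemma expBound_source {S : Set ℝ} {p : ℝ} (hS : ∀ x ∈ S, -3 * |x| ≤ p * x) (s : ℝ) (n : ℕ) :
    ExpBound S (-s + p) n (source s) := by
  have h := ((ExpBound.const s).add (ExpBound.kink.const_mul 3)).mul
    ((ExpBound.exp (-s)).mul (ExpBound.Q_cube (n := n) hS))
  rwa [zero_add] at h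

lemma abs_source_le {s : ℝ} (hs : 0 ≤ s) (x : ℝ) :
    |source s x| ≤ 10 * (s + 3) * Real.exp (-s * x - 3 * |x|) := by
  have h1 : |s + 3 * kink x| ≤ s + 3 := by
    have := abs_le.1 (abs_kink_le_one x)
    rw [abs_le]
    constructor <;> linarith
  rw [source, abs_mul, abs_mul, Real.abs_exp, abs_of_pos (pow_pos (Q_pos x) 3), sub_eq_add_neg,
    Real.exp_add, ← neg_mul]
  calc |s + 3 * kink x| * (Real.exp (-s * x) * Q x ^ 3)
      ≤ (s + 3) * (Real.exp (-s * x) * (10 * Real.exp (-3 * |x|))) := by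
        gcongr
        · exact mul_nonneg (Real.exp_pos _).le (pow_pos (Q_pos x) 3).le
        · exact Q_cube_le x
    _ = _ := by ring

lemma hasDerivAt_iteratedDeriv {f : ℝ → ℝ} (hf : ContDiff ℝ (⊤ : ℕ∞) f) (k : ℕ) (x : ℝ) :
    HasDerivAt (iteratedDeriv k f) (iteratedDeriv (k + 1) f x) x := by
  rw [iteratedDeriv_succ]
  exact ((contDiff_infty.1 hf (k + 1)).differentiable_iteratedDeriv' k x).hasDerivAt

lemma hasDerivAt_LQ {f : ℝ → ℝ} (hf : ContDiff ℝ (⊤ : ℕ∞) f) (x : ℝ) :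
    HasDerivAt (LQ f) (-iteratedDeriv 3 f x + iteratedDeriv 1 f x
      + (-4 * Q x ^ 3 * iteratedDeriv 1 f x + 12 * kink x * Q x ^ 3 * f x)) x := by
  have h0 := hasDerivAt_iteratedDeriv hf 0 x
  rw [iteratedDeriv_zero] at h0
  refine (((hasDerivAt_iteratedDeriv hf 2 x).neg.add h0).sub
    (((hasDerivAt_Q_cube x).const_mul 4).mul h0)).congr_deriv ?_
  simp only [zero_add, Nat.reduceAdd]
  ring

lemma IsAc.solvesOn {c : ℝ} {A : ℝ → ℝ} (hA : IsAc c A) :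
    SolvesOn (√c * (1 - c)) (source √c) univ (fun i => iteratedDeriv i A) := by
  have hd := fun k x => (hasDerivAt_iteratedDeriv hA.1 k x).hasDerivWithinAt (s := univ)
  refine ⟨fun x _ => hd 0 x, fun x _ => hd 1 x, fun x _ => (hd 2 x).congr_deriv ?_⟩
  have h := hA.2.2 x
  rw [(hasDerivAt_LQ hA.1 x).deriv, (hasDerivAt_exp_mul_Q_cube √c x).deriv] at h
  simp only [Fin.coe_ofNat_eq_mod, Nat.zero_mod, Nat.one_mod, iteratedDeriv_zero, Nat.reduceAdd]
  linarith

lemma IsAc.tendsto {c : ℝ} {A : ℝ → ℝ} (hA : IsAc c A) {k : ℕ} (hk : k < 10) :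
    Tendsto (iteratedDeriv k A) (cocompact ℝ) (𝓝 0) :=
  tendsto_zero_of_integrable_sq (hasDerivAt_iteratedDeriv hA.1 k)
    (continuous_iff_continuousAt.2 fun x =>
      (hasDerivAt_iteratedDeriv hA.1 (k + 1) x).continuousAt)
    (hA.2.1 k hk.le) (hA.2.1 (k + 1) hk)

lemma IsAc.unique {c : ℝ} (hc : 0 < c) (hc1 : c < 1) {A B : ℝ → ℝ} (hA : IsAc c A)
    (hB : IsAc c B) : B = A := by
  have hD := hB.solvesOn.add_smul hA.solvesOn (-1)
  have ht : ∀ k : Fin 3, Tendsto (((fun i : Fin 3 => iteratedDeriv i B)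
      + (-1 : ℝ) • fun i : Fin 3 => iteratedDeriv i A) k) (cocompact ℝ) (𝓝 0) := by
    intro k
    have h := (hB.tendsto (k := k) (by omega)).add
      ((hA.tendsto (k := k) (by omega)).const_smul (-1 : ℝ))
    rw [smul_zero, add_zero] at h
    exact h
  funext x
  have h := eq_zero_of_linearized_eigenfunction (mul_pos (Real.sqrt_pos.2 hc) (sub_pos.2 hc1))
    (fun x => hasDerivWithinAt_univ.1 (hD.hasDeriv_zero x trivial))
    (fun x => hasDerivWithinAt_univ.1 (hD.hasDeriv_one x trivial))
    (fun x => (hasDerivWithinAt_univ.1 (hD.hasDeriv_two x trivial)).congr_deriv (by simp))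
    (ht 0) (ht 1) (ht 2) x
  simp at h
  linarith

/-- The exponents `γ_c⁰`, `γ_c^I`, `√c` of the equation for `A_c`. -/
lemma exponents_Ac {c : ℝ} (hc : 3 / 4 ≤ c) (hc1 : c < 1) :
    Exponents (√c * (1 - c)) (√(1 - 3 / 4 * c) + 1 / 2 * √c)
      (√(1 - 3 / 4 * c) - 1 / 2 * √c) √c := by
  have hs2 : √c ^ 2 = c := Real.sq_sqrt (by linarith)
  have hw2 : √(1 - 3 / 4 * c) ^ 2 = 1 - 3 / 4 * c := Real.sq_sqrt (by linarith)
  have hs0 : 0 < √c := Real.sqrt_pos.2 (by linarith)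
  have hw0 : 0 < √(1 - 3 / 4 * c) := Real.sqrt_pos.2 (by linarith)
  generalize √c = s at *
  generalize √(1 - 3 / 4 * c) = w at *
  subst hs2
  have hs1 : s < 1 := by nlinarith
  have hws : 1 / 2 * s < w := by nlinarith
  have hw1 : w < 2 / 3 := by nlinarith
  have hs8 : 4 / 5 < s := by nlinarith
  refine ⟨mul_pos hs0 (by linarith), by linarith, by linarith, by linarith, by linarith,
    by linarith, ?_, ?_, ?_, ?_⟩
  · nlinarith [sq_nonneg (1 - s)]
  · linear_combination (w + 3 / 2 * s) * hw2
  · linear_combination (3 / 2 * s - w) * hw2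
  · ring

lemma expBound_perturbation {S : Set ℝ} {p q : ℝ} (hS : ∀ x ∈ S, -3 * |x| ≤ p * x) {n : ℕ}
    {F₀ F₁ : ℝ → ℝ} (h₀ : ExpBound S q n F₀) (h₁ : ExpBound S q n F₁) :
    ExpBound S (p + q) n (fun x => -4 * Q x ^ 3 * F₁ x + 12 * kink x * Q x ^ 3 * F₀ x) := by
  have hQ := ExpBound.Q_cube (n := n) hS
  have h1 := (hQ.const_mul (-4)).mul h₁
  have h2 := ((ExpBound.kink.const_mul 12).mul hQ).mul h₀
  rw [zero_add] at h2
  exact h1.add h2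

lemma SolvesOn.expBound_left {lam a s M : ℝ} {A : Fin 3 → ℝ → ℝ}
    (hA : SolvesOn lam (source s) univ A) (has : a + s ≤ 3)
    (h : ∀ k, ∀ x ≤ 0, |A k x| ≤ M * Real.exp (a * x)) (n : ℕ) : ExpBound (Iio 0) a n (A 0) := by
  have hS : ∀ x ∈ Iio (0 : ℝ), -3 * |x| ≤ 3 * x := fun x hx => by
    rw [abs_of_neg hx]; linarith
  have hsm := hA.contDiff (expBound_source hS s 0).1
  have hb : ∀ k, ExpBound (Iio 0) a 0 (A k) := fun k =>
    ExpBound.zero (hsm k) fun x hx => h k x (le_of_lt hx)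
  refine (ExpBound.of_system (hb 0) (hb 1) (hb 2)
    (fun x => hasDerivWithinAt_univ.1 (hA.hasDeriv_zero x trivial))
    (fun x => hasDerivWithinAt_univ.1 (hA.hasDeriv_one x trivial))
    (fun x => hasDerivWithinAt_univ.1 (hA.hasDeriv_two x trivial))
    (fun n h0 h1 => ?_) n).1
  refine (h1.add (h0.const_mul lam)).add (ExpBound.add ?_ ?_)
  · refine (expBound_perturbation hS h0 h1).mono fun x hx => ?_
    have hx : x < 0 := hx
    nlinarith
  · refine (expBound_source hS s n).mono fun x hx => ?_
    have hx : x < 0 := hx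
    nlinarith

lemma SolvesOn.expBound_right {lam a b s β γ M : ℝ} (he : Exponents lam a b s)
    {A : Fin 3 → ℝ → ℝ} (hA : SolvesOn lam (source s) univ A)
    (h : ∀ k : Fin 3, ∀ x, 0 ≤ x →
      |A k x - ((-b) ^ (k : ℕ) * β * Real.exp (-b * x) + (-s) ^ (k : ℕ) * γ * Real.exp (-s * x))|
        ≤ M * Real.exp (-(3 / 2) * x)) (n : ℕ) :
    ExpBound (Ioi 0) (-(3 / 2)) n
        (fun x => A 0 x - β * Real.exp (-b * x) - γ * Real.exp (-s * x)) ∧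
      ExpBound (Ioi 0) (-b) n (A 0) := by
  obtain ⟨hlam, hb, hbs, hs, ha, ha', has, hra, hrb, hrs⟩ := he
  have hS : ∀ x ∈ Ioi (0 : ℝ), -3 * |x| ≤ -3 * x := fun x hx => by
    rw [abs_of_pos hx]
  have hsm := hA.contDiff (expBound_source hS s 0).1
  have d0 := fun x => hasDerivWithinAt_univ.1 (hA.hasDeriv_zero x trivial)
  have d1 := fun x => hasDerivWithinAt_univ.1 (hA.hasDeriv_one x trivial)
  have d2 := fun x => hasDerivWithinAt_univ.1 (hA.hasDeriv_two x trivial)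
  set E : ℕ → ℝ → ℝ := fun k x =>
    (-b) ^ k * β * Real.exp (-b * x) + (-s) ^ k * γ * Real.exp (-s * x) with hE
  have dE : ∀ k x, HasDerivAt (E k) (E (k + 1) x) x := fun k x => by
    refine (((((hasDerivAt_id x).const_mul (-b)).exp).const_mul ((-b) ^ k * β)).add
      ((((hasDerivAt_id x).const_mul (-s)).exp).const_mul ((-s) ^ k * γ))).congr_deriv ?_
    simp only [hE, id]
    ring
  have bE : ∀ k n, ExpBound (Ioi 0) (-b) n (E k) := fun k n => by
    refine ((ExpBound.exp (-b)).const_mul _).add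
      (((ExpBound.exp (-s)).mono fun x hx => ?_).const_mul _)
    have hx : 0 < x := hx
    nlinarith
  have hR0 : ∀ k : Fin 3, ExpBound (Ioi 0) (-(3 / 2)) 0 (fun x => A k x - E k x) := fun k =>
    ExpBound.zero ((hsm k).sub (bE k 0).1) fun x hx => h k x (le_of_lt hx)
  have hAR : ∀ (k : Fin 3) n, ExpBound (Ioi 0) (-(3 / 2)) n (fun x => A k x - E k x) →
      ExpBound (Ioi 0) (-b) n (A k) := fun k n hk => by
    have h := (hk.mono (q := -b) fun x hx => ?_).add (bE k n)
    · simpa using h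
    · have hx : 0 < x := hx
      nlinarith
  have hR := (ExpBound.of_system (hR0 0) (hR0 1) (hR0 2)
    (F₃ := fun x => (A 1 x - E 1 x) + lam * (A 0 x - E 0 x)
      + ((-4 * Q x ^ 3 * A 1 x + 12 * kink x * Q x ^ 3 * A 0 x) + source s x))
    (fun x => (d0 x).sub (dE 0 x)) (fun x => (d1 x).sub (dE 1 x))
    (fun x => ((d2 x).sub (dE 2 x)).congr_deriv (by
      simp only [hE, Nat.reduceAdd, hrb, hrs]
      ring))
    (fun n h0 h1 => by
      refine (h1.add (h0.const_mul lam)).add (ExpBound.add ?_ ?_)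
      · refine (expBound_perturbation hS (hAR 0 n h0) (hAR 1 n h1)).mono fun x hx => ?_
        have hx : 0 < x := hx
        nlinarith
      · refine (expBound_source hS s n).mono fun x hx => ?_
        have hx : 0 < x := hx
        nlinarith) n).1
  refine ⟨?_, hAR 0 n hR⟩
  convert hR using 2
  simp [hE, sub_sub]

/-- For `3/4 ≤ c < 1` there is a unique solution `A_c` of
`(L A_c)' + √c(1−c) A_c = G_c'`, and it has exponential decay `e^{γ_c⁰ x}` on the left
and `e^{−γ_c^I x}` on the right, with two-term asymptotics
`a_c^I e^{−γ_c^I x} + a_c^{II} e^{−√c x}` at `+∞`. -/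
theorem existence_uniqueness_Ac (c : ℝ) (hc : 3 / 4 ≤ c) (hc1 : c < 1) :
    ∃ A : ℝ → ℝ, IsAc c A ∧ (∀ B : ℝ → ℝ, IsAc c B → B = A) ∧
      (∀ k : ℕ, ∃ C : ℝ, 0 < C ∧
        (∀ x : ℝ, x < 0 → |iteratedDeriv k A x|
          ≤ C * Real.exp ((Real.sqrt (1 - 3 / 4 * c) + 1 / 2 * Real.sqrt c) * x)) ∧
        (∀ x : ℝ, 0 < x → |iteratedDeriv k A x|
          ≤ C * Real.exp (-(Real.sqrt (1 - 3 / 4 * c) - 1 / 2 * Real.sqrt c) * x))) ∧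
      (∃ aI aII : ℝ, ∀ k : ℕ, ∃ C : ℝ, 0 < C ∧ ∀ x : ℝ, 0 < x →
        |iteratedDeriv k (fun y => A y
            - aI * Real.exp (-(Real.sqrt (1 - 3 / 4 * c) - 1 / 2 * Real.sqrt c) * y)
            - aII * Real.exp (-(Real.sqrt c) * y)) x|
          ≤ C * Real.exp (-(3 / 2) * x)) := by
  have he := exponents_Ac hc hc1
  have hs0 : 0 ≤ √c := Real.sqrt_nonneg c
  have hsource : ContDiff ℝ (⊤ : ℕ∞) (source √c) :=
    (expBound_source (S := ∅) (p := 0) (by simp) √c 0).1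
  obtain ⟨A, β, γ, M, hA, hAl, hAr⟩ := he.exists_global (g := source √c) (K := 10 * (√c + 3))
    hsource.continuous (by positivity)
    (fun x hx => (abs_source_le hs0 x).trans (by
      rw [abs_of_nonneg hx]
      gcongr
      nlinarith [he.a_pos]))
    (fun x hx => (abs_source_le hs0 x).trans (by
      rw [abs_of_nonpos hx]
      gcongr
      linarith))
  have hleft := hA.expBound_left (by linarith [he.add_le]) hAl
  have hright := hA.expBound_right he hAr
  have hd0 : deriv (A 0) = A 1 := funext fun x =>
    (hasDerivWithinAt_univ.1 (hA.hasDeriv_zero x trivial)).deriv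
  have hd1 : deriv (A 1) = A 2 := funext fun x =>
    (hasDerivWithinAt_univ.1 (hA.hasDeriv_one x trivial)).deriv
  have hd2 := fun x => (hasDerivWithinAt_univ.1 (hA.hasDeriv_two x trivial)).deriv
  have hsm : ContDiff ℝ (⊤ : ℕ∞) (A 0) := hA.contDiff hsource 0
  have hbound : ∀ k : ℕ, ∃ C : ℝ, 0 < C ∧
      (∀ x : ℝ, x < 0 → |iteratedDeriv k (A 0) x|
        ≤ C * Real.exp ((√(1 - 3 / 4 * c) + 1 / 2 * √c) * x)) ∧
      (∀ x : ℝ, 0 < x → |iteratedDeriv k (A 0) x|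
        ≤ C * Real.exp (-(√(1 - 3 / 4 * c) - 1 / 2 * √c) * x)) := by
    intro k
    obtain ⟨C, hC0, hC⟩ := (hleft k).exists_nonneg le_rfl
    obtain ⟨D, hD0, hD⟩ := (hright k).2.exists_nonneg le_rfl
    refine ⟨C + D + 1, by positivity, fun x hx => (hC x hx).trans ?_,
      fun x hx => (hD x hx).trans ?_⟩ <;> gcongr <;> linarith
  have hAc : IsAc c (A 0) := by
    refine ⟨hsm, fun k _ => ?_, fun x => ?_⟩
    · obtain ⟨C, -, hl, hr⟩ := hbound k
      exact integrable_sq_of_abs_le_exp (continuous_iff_continuousAt.2 fun x =>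
        (hasDerivAt_iteratedDeriv hsm k x).continuousAt) he.a_pos he.b_pos hl hr
    · rw [(hasDerivAt_LQ hsm x).deriv, (hasDerivAt_exp_mul_Q_cube √c x).deriv, iteratedDeriv_one,
        iteratedDeriv_succ', iteratedDeriv_succ', iteratedDeriv_one, hd0, hd1, hd2]
      ring
  refine ⟨A 0, hAc, fun B hB => hAc.unique (by linarith) hc1 hB, hbound, β, γ, fun k => ?_⟩
  obtain ⟨C, hC0, hC⟩ := (hright k).1.exists_nonneg le_rfl
  refine ⟨C + 1, by positivity, fun x hx => (hC x hx).trans ?_⟩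
  gcongr
  linarith
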